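/- Let K be a complete discrete valuation field with finite residue field, L/K a finite totally ramified abelian extension, and u ∈ O_K^×. Then there exist a finite unramified extension K'/K and a unit u' ∈ O_{L'}^× with L' = K'L such that u = N_{L'/K'}(u'). -/

import Mathlib

local notation "Γ₀" => WithZero (Multiplicative ℤ)

/-- A witness for Lemma 2.4: a finite unramified extension `K'/K`, the compositum
`L' = K'L`, and a unit `u' ∈ O_{L'}^×` whose norm to `K'` is (the image of) `u`. -/
structure UnramifiedNormWitness (K L : Type*) [Field K] [Field L] [Algebra K L]
    [Valued K Γ₀] [Valued L Γ₀] (u : K) where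
  K' : Type*
  L' : Type*
  [fK' : Field K']
  [fL' : Field L']
  [vK' : Valued K' Γ₀]
  [vL' : Valued L' Γ₀]
  [aKK' : Algebra K K']
  [aK'L' : Algebra K' L']
  [aLL' : Algebra L L']
  [aKL' : Algebra K L']
  [tow1 : IsScalarTower K K' L']
  [tow2 : IsScalarTower K L L']
  [fd : FiniteDimensional K K']
  [fdL' : FiniteDimensional K' L']
  /-- `K'/K` is unramified: the valuation extends with ramification index `1`. -/
  unram : ∀ x : K, Valued.v (algebraMap K K' x) = Valued.v x
  /-- the valuation of `K'` is still normalized (value group `ℤ`) -/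
  normalized : ∃ π : K', Valued.v π =
    ((Multiplicative.ofAdd (-1 : ℤ) : Multiplicative ℤ) : Γ₀)
  /-- `L'/L` is likewise unramified -/
  unramL : ∀ x : L, Valued.v (algebraMap L L' x) = Valued.v x
  /-- `L'` is the compositum `K'L` -/
  compositum : Algebra.adjoin K
    (Set.range (algebraMap K' L') ∪ Set.range (algebraMap L L')) =
      (⊤ : Subalgebra K L')
  /-- the unit `u' ∈ O_{L'}^×` -/
  u' : L'
  hu' : Valued.v u' = 1
  /-- `u = N_{L'/K'}(u')` -/
  hnorm : Algebra.norm K' u' = algebraMap K K' u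

section Valuations

open WithZero Polynomial

theorem WithZero.exists_eq_exp {x : Γ₀} (hx : x ≠ 0) : ∃ k : ℤ, x = exp k :=
  ⟨log x, (exp_log hx).symm⟩

theorem WithZero.exp_pow (k : ℤ) (n : ℕ) : (exp k : Γ₀) ^ n = exp (n * k) := by
  rw [← exp_nsmul, nsmul_eq_mul]

theorem WithZero.lt_exp_iff {x : Γ₀} {k : ℤ} : x < exp k ↔ x ≤ exp (k - 1) := by
  rcases eq_or_ne x 0 with rfl | hx
  · simp only [exp_pos, zero_le]
  · obtain ⟨m, rfl⟩ := exists_eq_exp hx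
    rw [exp_lt_exp, exp_le_exp]
    omega

/-- A finite extension `L / K` of fields carrying normalized discrete valuations `v`, `w` is
totally ramified if `w` restricts to `v ^ [L : K]`. -/
structure Valuation.IsTotallyRamified {K L : Type*} [Field K] [Field L] [Algebra K L]
    (v : Valuation K Γ₀) (w : Valuation L Γ₀) : Prop where
  exists_uniformizer : ∃ π : K, v π = exp (-1)
  exists_uniformizer' : ∃ π : L, w π = exp (-1)
  map_algebraMap : ∀ x : K, w (algebraMap K L x) = v x ^ Module.finrank K L

namespace Valuation

section

variable {K : Type*} [Field K] (v : Valuation K Γ₀)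

theorem exists_map_eq_exp (h : ∃ π : K, v π = exp (-1)) (k : ℤ) : ∃ x : K, v x = exp k := by
  obtain ⟨π, hπ⟩ := h
  refine ⟨π ^ (-k), ?_⟩
  rw [map_zpow₀, hπ, ← exp_zsmul]
  simp

theorem infinite_of_uniformizer (h : ∃ π : K, v π = exp (-1)) : Infinite K := by
  choose f hf using v.exists_map_eq_exp h
  refine Infinite.of_injective f fun a b hab => ?_
  have := hf a
  rw [hab, hf b] at this
  exact (exp_injective this).symm

theorem le_map_sum_of_ne {ι : Type*} (s : Finset ι) (f : ι → K)
    (h : ∀ i ∈ s, ∀ j ∈ s, i ≠ j → f i ≠ 0 → v (f i) ≠ v (f j)) :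
    ∀ i ∈ s, v (f i) ≤ v (∑ j ∈ s, f j) := by
  classical
  intro i hi
  obtain ⟨m, hm, hmax⟩ := s.exists_max_image (fun i => v (f i)) ⟨i, hi⟩
  by_cases h0 : f m = 0
  · have := hmax i hi
    simp only [h0, map_zero, le_zero_iff] at this
    simp [this]
  · rw [v.map_sum_eq_of_lt hm]
    · exact hmax i hi
    · intro j hj
      rw [Finset.mem_sdiff, Finset.mem_singleton] at hj
      exact lt_of_le_of_ne (hmax j hj.1) (h m hm j hj.1 (Ne.symm hj.2) h0).symm

end

namespace IsTotallyRamified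

variable {K L : Type*} [Field K] [Field L] [Algebra K L] [FiniteDimensional K L]
  {v : Valuation K Γ₀} {w : Valuation L Γ₀}

theorem le_map_sum (h : IsTotallyRamified v w) {ϖ : L} (hϖ : w ϖ = exp (-1))
    (a : Fin (Module.finrank K L) → K) (i : Fin (Module.finrank K L)) :
    v (a i) ^ Module.finrank K L * exp (-(i : ℤ)) ≤ w (∑ j, a j • ϖ ^ (j : ℕ)) := by
  have key (j : Fin (Module.finrank K L)) :
      w (a j • ϖ ^ (j : ℕ)) = v (a j) ^ Module.finrank K L * exp (-(j : ℤ)) := by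
    rw [Algebra.smul_def, map_mul, h.map_algebraMap, map_pow, hϖ, exp_pow]
    simp
  rw [← key]
  refine w.le_map_sum_of_ne Finset.univ (fun j => a j • ϖ ^ (j : ℕ)) (fun i _ j _ hij hi hv => ?_) i (Finset.mem_univ i)
  have hai : v (a i) ≠ 0 := by
    rw [Valuation.ne_zero_iff]
    rintro h0
    simp [h0] at hi
  have haj : v (a j) ≠ 0 := by
    intro h0
    have : w (a i • ϖ ^ (i : ℕ)) ≠ 0 := (w.ne_zero_iff).2 hi
    rw [hv, key, h0] at this
    simp [Module.finrank_pos.ne'] at this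
  rw [key, key] at hv
  obtain ⟨m, hm⟩ := exists_eq_exp hai
  obtain ⟨n, hn⟩ := exists_eq_exp haj
  rw [hm, hn, exp_pow, exp_pow, ← exp_add, ← exp_add, exp_inj] at hv
  apply hij
  have hi' := i.2
  have hj' := j.2
  have : (Module.finrank K L : ℤ) * (m - n) = i - j := by linarith
  have h2 : (Module.finrank K L : ℤ) ∣ (i : ℤ) - j := ⟨_, this.symm⟩
  have h3 := Int.eq_zero_of_abs_lt_dvd h2 (by rw [abs_lt]; constructor <;> omega)
  apply Fin.ext
  omega

theorem linearIndependent (h : IsTotallyRamified v w) {ϖ : L} (hϖ : w ϖ = exp (-1)) :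
    LinearIndependent K fun i : Fin (Module.finrank K L) => ϖ ^ (i : ℕ) := by
  rw [Fintype.linearIndependent_iff]
  intro a ha i
  have := h.le_map_sum hϖ a i
  rw [ha, map_zero, le_zero_iff] at this
  simpa [Module.finrank_pos.ne'] using this

/-- The powers of a uniformizer form a basis of a totally ramified extension. -/
noncomputable def basis (h : IsTotallyRamified v w) {ϖ : L} (hϖ : w ϖ = exp (-1)) :
    Module.Basis (Fin (Module.finrank K L)) K L :=
  haveI : Nonempty (Fin (Module.finrank K L)) := ⟨0, Module.finrank_pos⟩
  basisOfLinearIndependentOfCardEqFinrank (h.linearIndependent hϖ) (by simp)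

theorem basis_apply (h : IsTotallyRamified v w) {ϖ : L} (hϖ : w ϖ = exp (-1))
    (i : Fin (Module.finrank K L)) : h.basis hϖ i = ϖ ^ (i : ℕ) := by
  simp [basis]

theorem sum_repr (h : IsTotallyRamified v w) {ϖ : L} (hϖ : w ϖ = exp (-1)) (x : L) :
    ∑ i, (h.basis hϖ).repr x i • ϖ ^ (i : ℕ) = x := by
  simpa only [basis_apply] using (h.basis hϖ).sum_repr x

theorem repr_le (h : IsTotallyRamified v w) {ϖ : L} (hϖ : w ϖ = exp (-1)) (x : L)
    (i : Fin (Module.finrank K L)) :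
    v ((h.basis hϖ).repr x i) ^ Module.finrank K L * exp (-(i : ℤ)) ≤ w x := by
  simpa only [sum_repr] using h.le_map_sum hϖ ((h.basis hϖ).repr x) i

theorem repr_le_one (h : IsTotallyRamified v w) {ϖ : L} (hϖ : w ϖ = exp (-1)) {x : L}
    (hx : w x ≤ 1) (i : Fin (Module.finrank K L)) : v ((h.basis hϖ).repr x i) ≤ 1 := by
  have h1 := (h.repr_le hϖ x i).trans hx
  by_cases h0 : v ((h.basis hϖ).repr x i) = 0
  · simp [h0]
  obtain ⟨m, hm⟩ := exists_eq_exp h0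
  rw [hm, exp_pow, ← exp_add, ← exp_zero, exp_le_exp] at h1
  rw [hm, ← exp_zero, exp_le_exp]
  have := i.2
  by_contra! hm0
  nlinarith

/-- The coefficients of `ϖ ^ n` with respect to the basis of powers of `ϖ` lie in the maximal
ideal. -/
theorem repr_pow_finrank_lt_one (h : IsTotallyRamified v w) {ϖ : L} (hϖ : w ϖ = exp (-1))
    (i : Fin (Module.finrank K L)) :
    v ((h.basis hϖ).repr (ϖ ^ Module.finrank K L) i) < 1 := by
  have h1 := h.repr_le hϖ (ϖ ^ Module.finrank K L) i
  by_cases h0 : v ((h.basis hϖ).repr (ϖ ^ Module.finrank K L) i) = 0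
  · simp [h0]
  obtain ⟨m, hm⟩ := exists_eq_exp h0
  rw [hm, exp_pow, ← exp_add, map_pow, hϖ, exp_pow, exp_le_exp] at h1
  rw [hm, ← exp_zero, exp_lt_exp]
  have := i.2
  by_contra! hm0
  nlinarith

theorem map_uniformizer_le_one (h : IsTotallyRamified v w) {ϖ : L} (hϖ : w ϖ = exp (-1))
    (w' : Valuation L Γ₀) (hw' : ∀ x : K, w' (algebraMap K L x) = w (algebraMap K L x)) :
    w' ϖ ≤ 1 := by
  by_contra! hlt
  have h1 : w' (ϖ ^ Module.finrank K L) < w' ϖ ^ Module.finrank K L := by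
    conv_lhs => rw [← h.sum_repr hϖ (ϖ ^ Module.finrank K L)]
    refine w'.map_sum_lt (pow_ne_zero _ (zero_lt_one.trans hlt).ne') fun i _ => ?_
    rw [Algebra.smul_def, map_mul, hw', h.map_algebraMap, map_pow w']
    calc _ ≤ 1 * w' ϖ ^ (i : ℕ) := by
          gcongr
          exact pow_le_one₀ zero_le (h.repr_pow_finrank_lt_one hϖ i).le
      _ < _ := by
          rw [one_mul]
          exact pow_lt_pow_right₀ hlt i.2
  simp at h1

theorem le_one_of_le_one (h : IsTotallyRamified v w)
    (w' : Valuation L Γ₀) (hw' : ∀ x : K, w' (algebraMap K L x) = w (algebraMap K L x))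
    {x : L} (hx : w x ≤ 1) : w' x ≤ 1 := by
  obtain ⟨ϖ, hϖ⟩ := h.exists_uniformizer'
  rw [← h.sum_repr hϖ x]
  refine w'.map_sum_le fun i _ => ?_
  rw [Algebra.smul_def, map_mul, hw', h.map_algebraMap, map_pow]
  exact mul_le_one' (pow_le_one₀ zero_le (h.repr_le_one hϖ hx i))
    (pow_le_one₀ zero_le (h.map_uniformizer_le_one hϖ w' hw'))

theorem eq_one_of_eq_one (h : IsTotallyRamified v w)
    (w' : Valuation L Γ₀) (hw' : ∀ x : K, w' (algebraMap K L x) = w (algebraMap K L x))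
    {x : L} (hx : w x = 1) : w' x = 1 := by
  refine le_antisymm (h.le_one_of_le_one w' hw' hx.le) ?_
  have := h.le_one_of_le_one w' hw' (x := x⁻¹) (by simp [hx])
  rw [map_inv₀] at this
  refine (inv_le_one₀ ?_).1 this
  rw [zero_lt_iff, Valuation.ne_zero_iff]
  rintro rfl
  simp at hx

/-- A totally ramified extension admits a unique extension of the valuation. -/
theorem eq_of_map_algebraMap_eq (h : IsTotallyRamified v w)
    (w' : Valuation L Γ₀) (hw' : ∀ x : K, w' (algebraMap K L x) = w (algebraMap K L x))
    (x : L) : w' x = w x := by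
  rcases eq_or_ne x 0 with rfl | hx
  · simp
  obtain ⟨k, hk⟩ := exists_eq_exp ((w.ne_zero_iff).2 hx)
  obtain ⟨a, ha⟩ := v.exists_map_eq_exp h.exists_uniformizer k
  have hd : Module.finrank K L ≠ 0 := Module.finrank_pos.ne'
  have ha' : w (algebraMap K L a) = w (x ^ Module.finrank K L) := by
    rw [h.map_algebraMap, ha, map_pow, hk]
  have hw0 : w (x ^ Module.finrank K L) ≠ 0 := (w.ne_zero_iff).2 (pow_ne_zero _ hx)
  have h1 := h.eq_one_of_eq_one w' hw' (x := x ^ Module.finrank K L / algebraMap K L a) (by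
    rw [map_div₀, ha', div_self hw0])
  rw [map_div₀, hw', ha', div_eq_one_iff_eq hw0, map_pow, map_pow] at h1
  exact (pow_left_inj₀ zero_le zero_le hd).1 h1

theorem map_algEquiv (h : IsTotallyRamified v w) (σ : L ≃ₐ[K] L) (x : L) : w (σ x) = w x :=
  h.eq_of_map_algebraMap_eq (w.comap (σ : L →+* L)) (fun x => by simp [Valuation.comap_apply]) x

theorem map_norm [IsGalois K L] (h : IsTotallyRamified v w) (x : L) :
    v (Algebra.norm K x) = w x := by
  have h1 := congrArg w (Algebra.norm_eq_prod_automorphisms K x)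
  rw [h.map_algebraMap, map_prod] at h1
  simp only [h.map_algEquiv, Finset.prod_const, Finset.card_univ] at h1
  rw [← Nat.card_eq_fintype_card, IsGalois.card_aut_eq_finrank] at h1
  exact (pow_left_inj₀ zero_le zero_le Module.finrank_pos.ne').1 h1

end IsTotallyRamified

end Valuation

open scoped Pointwise in
theorem MulAction.exists_finset_sum_eq_sum_smul {G X B : Type*} [Group G] [Fintype G]
    [MulAction G X] [DecidableEq X] [AddCommMonoid B] (T : Finset X)
    (hT : ∀ x ∈ T, ∀ g : G, g • x ∈ T) (hfree : ∀ x ∈ T, ∀ g : G, g • x = x → g = 1) :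
    ∃ R ⊆ T, ∀ F : X → B, ∑ x ∈ T, F x = ∑ x ∈ R, ∑ g : G, F (g • x) := by
  induction T using Finset.strongInduction with
  | H T ih =>
    rcases T.eq_empty_or_nonempty with rfl | ⟨x, hx⟩
    · exact ⟨∅, subset_rfl, fun F => by simp⟩
    set O : Finset X := Finset.univ.image fun g : G => g • x with hO
    have hOT : O ⊆ T := by
      intro y hy
      obtain ⟨g, -, rfl⟩ := Finset.mem_image.1 hy
      exact hT x hx g
    have hxO : x ∈ O := Finset.mem_image.2 ⟨1, Finset.mem_univ _, one_smul _ _⟩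
    obtain ⟨R, hR, hRF⟩ := ih (T \ O) (Finset.sdiff_ssubset hOT ⟨x, hxO⟩)
      (by
        intro y hy g
        rw [Finset.mem_sdiff] at hy ⊢
        refine ⟨hT y hy.1 g, fun hgy => hy.2 ?_⟩
        obtain ⟨g', -, hg'⟩ := Finset.mem_image.1 hgy
        exact Finset.mem_image.2 ⟨g⁻¹ * g', Finset.mem_univ _, by
          rw [mul_smul]
          exact (inv_smul_eq_iff).2 hg'⟩)
      (fun y hy => hfree y (Finset.mem_sdiff.1 hy).1)
    have hxR : x ∉ R := fun h => (Finset.mem_sdiff.1 (hR h)).2 hxO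
    refine ⟨insert x R, Finset.insert_subset hx (hR.trans Finset.sdiff_subset), fun F => ?_⟩
    rw [Finset.sum_insert hxR, ← hRF, ← Finset.sum_sdiff hOT, add_comm, hO, Finset.sum_image]
    intro g _ g' _ hgg'
    have := hfree x hx (g'⁻¹ * g) (by
      rw [mul_smul]
      exact (inv_smul_eq_iff).2 hgg')
    exact (inv_mul_eq_one.1 this).symm

open scoped Pointwise in
/-- If the finite group `G` has no proper nontrivial subgroups, the norm is additive up to
traces. -/
theorem exists_prod_one_add_smul_eq {G B : Type*} [Group G] [Fintype G] [DecidableEq G]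
    [CommRing B] [MulSemiringAction G B] (hG : ∀ H : Subgroup G, H = ⊥ ∨ H = ⊤) (x : B) :
    ∃ R : Finset (Finset G), (∀ I ∈ R, I.Nonempty) ∧
      ∏ g : G, (1 + g • x) = 1 + ∏ g : G, g • x + ∑ g : G, g • ∑ I ∈ R, ∏ h ∈ I, h • x := by
  set T : Finset (Finset G) := Finset.univ \ {∅, Finset.univ} with hT
  have mem_T (I : Finset G) : I ∈ T ↔ I ≠ ∅ ∧ I ≠ Finset.univ := by simp [hT]
  obtain ⟨R, hR, hRF⟩ := MulAction.exists_finset_sum_eq_sum_smul (G := G) (B := B) T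
    (by
      intro I hI g
      rw [mem_T] at hI ⊢
      refine ⟨fun h => hI.1 (by simpa using h), fun h => hI.2 ?_⟩
      rw [smul_eq_iff_eq_inv_smul] at h
      rw [h]
      simp)
    (by
      intro I hI g hg
      rw [mem_T] at hI
      rcases hG (MulAction.stabilizer G I) with h | h
      · have : g ∈ MulAction.stabilizer G I := hg
        rwa [h, Subgroup.mem_bot] at this
      · exfalso
        obtain ⟨i, hi⟩ := Finset.nonempty_iff_ne_empty.2 hI.1
        refine hI.2 (Finset.eq_univ_iff_forall.2 fun k => ?_)
        have hk : k * i⁻¹ ∈ MulAction.stabilizer G I := h ▸ Subgroup.mem_top _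
        rw [MulAction.mem_stabilizer_iff] at hk
        rw [← hk]
        exact Finset.mem_smul_finset.2 ⟨i, hi, by simp⟩)
  refine ⟨R, fun I hI => Finset.nonempty_iff_ne_empty.2 ((mem_T I).1 (hR hI)).1, ?_⟩
  have hsub : ({∅, Finset.univ} : Finset (Finset G)) ⊆ Finset.univ := Finset.subset_univ _
  have hne : (∅ : Finset G) ≠ Finset.univ := Finset.univ_nonempty.ne_empty.symm
  rw [Finset.prod_one_add, Finset.powerset_univ, ← Finset.sum_sdiff hsub, ← hT,
    hRF fun I => ∏ h ∈ I, h • x, Finset.sum_pair hne, Finset.prod_empty, add_comm,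
    Finset.sum_comm]
  congr 1
  refine Finset.sum_congr rfl fun g _ => ?_
  rw [Finset.smul_sum]
  refine Finset.sum_congr rfl fun I _ => ?_
  rw [Finset.smul_prod', Finset.smul_finset_def, Finset.prod_image]
  · simp only [smul_eq_mul, mul_smul]
  · exact fun a _ b _ h => mul_left_cancel h

namespace Valuation

section CoeffLE

variable {K : Type*} [Field K]

/-- All coefficients of `p` have valuation at most `exp (-k)`. -/
def CoeffLE (v : Valuation K Γ₀) (k : ℤ) (p : K[X]) : Prop :=
  ∀ i, v (p.coeff i) ≤ exp (-k)

variable {v : Valuation K Γ₀} {k l : ℤ} {p q : K[X]}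

theorem CoeffLE.mono (hp : v.CoeffLE k p) (h : l ≤ k) : v.CoeffLE l p :=
  fun i => (hp i).trans (exp_le_exp.2 (by omega))

theorem CoeffLE.add (hp : v.CoeffLE k p) (hq : v.CoeffLE k q) : v.CoeffLE k (p + q) :=
  fun i => by
    rw [coeff_add]
    exact v.map_add_le (hp i) (hq i)

theorem CoeffLE.neg (hp : v.CoeffLE k p) : v.CoeffLE k (-p) :=
  fun i => by
    rw [coeff_neg, Valuation.map_neg]
    exact hp i

theorem CoeffLE.sub (hp : v.CoeffLE k p) (hq : v.CoeffLE k q) : v.CoeffLE k (p - q) := by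
  rw [sub_eq_add_neg]
  exact hp.add hq.neg

theorem CoeffLE.mul (hp : v.CoeffLE k p) (hq : v.CoeffLE l q) : v.CoeffLE (k + l) (p * q) :=
  fun i => by
    rw [coeff_mul]
    refine v.map_sum_le fun x _ => ?_
    rw [map_mul, neg_add, exp_add]
    exact mul_le_mul' (hp _) (hq _)

theorem CoeffLE.sum {ι : Type*} {s : Finset ι} {f : ι → K[X]}
    (h : ∀ i ∈ s, v.CoeffLE k (f i)) : v.CoeffLE k (∑ i ∈ s, f i) :=
  fun i => by
    rw [finsetSum_coeff]
    exact v.map_sum_le fun x hx => h x hx i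

theorem CoeffLE.prod {ι : Type*} {s : Finset ι} {f : ι → K[X]}
    (h : ∀ i ∈ s, v.CoeffLE k (f i)) : v.CoeffLE (s.card * k) (∏ i ∈ s, f i) := by
  classical
  induction s using Finset.induction_on with
  | empty =>
    intro i
    simp only [Finset.prod_empty, Finset.card_empty, coeff_one]
    split_ifs <;> simp
  | insert a s ha ih =>
    rw [Finset.prod_insert ha, Finset.card_insert_of_notMem ha]
    have := (h a (Finset.mem_insert_self a s)).mul
      (ih fun i hi => h i (Finset.mem_insert_of_mem hi))
    exact this.mono (by push_cast; linarith)

theorem coeffLE_C_mul_X_iff {y : K} : v.CoeffLE k (C y * X) ↔ v y ≤ exp (-k) := by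
  refine ⟨fun h => by simpa using h 1, fun h i => ?_⟩
  rw [coeff_C_mul, coeff_X]
  split_ifs
  · simpa using h
  · simp

end CoeffLE

section NormJump

variable {K L : Type*} [Field K] [Field L] [Algebra K L]

/-- The norm of `L / K` maps the `j`-th step of the unit filtration to the `n`-th one, and the
induced map on the graded pieces is a nonconstant polynomial. -/
structure NormJump (v : Valuation K Γ₀) (w : Valuation L Γ₀) (n j : ℤ) : Prop where
  one_le : 1 ≤ j
  exists_norm_eq : ∀ p : L[X], w.CoeffLE j p → ∃ q : K[X], v.CoeffLE n q ∧
    ∀ z : K, Algebra.norm K (1 + p.eval (algebraMap K L z)) = 1 + q.eval z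
  exists_norm_eq_succ : ∀ p : L[X], w.CoeffLE (j + 1) p → ∃ q : K[X], v.CoeffLE (n + 1) q ∧
    ∀ z : K, Algebra.norm K (1 + p.eval (algebraMap K L z)) = 1 + q.eval z
  exists_nonconstant : ∃ y : L, w y = exp (-j) ∧ ∃ q : K[X], v.CoeffLE n q ∧
    (∃ i, 1 ≤ i ∧ v (q.coeff i) = exp (-n)) ∧
    ∀ z : K, Algebra.norm K (1 + algebraMap K L z * y) = 1 + q.eval z

end NormJump

namespace IsTotallyRamified

variable {K L : Type*} [Field K] [Field L] [Algebra K L] [FiniteDimensional K L]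
  {v : Valuation K Γ₀} {w : Valuation L Γ₀}

theorem map_trace_pow_le [IsGalois K L] (h : IsTotallyRamified v w) (x : L) :
    v (Algebra.trace K L x) ^ Module.finrank K L ≤ w x := by
  rw [← h.map_algebraMap, trace_eq_sum_automorphisms]
  exact w.map_sum_le fun σ _ => (h.map_algEquiv σ x).le

/-- The different exponent, in disguise: there is a jump `J` at level `n` of the filtration of
`K` induced by the trace. -/
theorem exists_trace_jump [IsGalois K L] (h : IsTotallyRamified v w) (n : ℤ) :
    ∃ J : ℤ, (∀ y, w y ≤ exp (-J) → v (Algebra.trace K L y) ≤ exp (-n)) ∧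
      (∀ y, w y ≤ exp (-(J + 1)) → v (Algebra.trace K L y) ≤ exp (-(n + 1))) ∧
      ∃ y, w y ≤ exp (-J) ∧ v (Algebra.trace K L y) = exp (-n) := by
  have hd : 0 < Module.finrank K L := Module.finrank_pos
  set P : ℤ → Prop := fun j => ∀ y, w y ≤ exp (-j) → v (Algebra.trace K L y) ≤ exp (-(n + 1))
    with hP
  have hne : ∃ j, P j := by
    refine ⟨Module.finrank K L * (n + 1), fun y hy => ?_⟩
    have := (h.map_trace_pow_le y).trans hy
    rw [← mul_neg, ← exp_pow] at this
    exact (pow_le_pow_iff_left₀ zero_le zero_le hd.ne').1 this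
  have hbdd : ∃ b, ∀ j, P j → b ≤ j := by
    obtain ⟨y, hy⟩ : ∃ y, Algebra.trace K L y ≠ 0 := by
      by_contra! h0
      exact Algebra.trace_ne_zero K L (LinearMap.ext h0)
    have hy0 : y ≠ 0 := by
      rintro rfl
      simp at hy
    obtain ⟨a, ha⟩ := exists_eq_exp ((v.ne_zero_iff).2 hy)
    obtain ⟨b, hb⟩ := exists_eq_exp ((w.ne_zero_iff).2 hy0)
    obtain ⟨c, hc⟩ := v.exists_map_eq_exp h.exists_uniformizer (-n - a)
    refine ⟨-b - Module.finrank K L * (-n - a), fun j hj => ?_⟩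
    by_contra! hlt
    have h1 := hj (c • y) (by
      rw [Algebra.smul_def, map_mul, h.map_algebraMap, hb, hc, exp_pow, ← exp_add, exp_le_exp]
      linarith)
    rw [map_smul, smul_eq_mul, map_mul, ha, hc, ← exp_add, exp_le_exp] at h1
    linarith
  obtain ⟨b, hb⟩ := hbdd
  obtain ⟨m, hm, hmin⟩ := Int.exists_least_of_bdd ⟨b, hb⟩ hne
  have h1 : ∀ y, w y ≤ exp (-(m - 1)) → v (Algebra.trace K L y) ≤ exp (-n) := by
    intro y hy
    obtain ⟨c, hc⟩ := v.exists_map_eq_exp h.exists_uniformizer (-1)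
    have := hm (c • y) (by
      rw [Algebra.smul_def, map_mul, h.map_algebraMap, hc, exp_pow]
      calc _ ≤ exp (Module.finrank K L * (-1) : ℤ) * exp (-(m - 1)) := by gcongr
        _ ≤ _ := by
          rw [← exp_add, exp_le_exp]
          have : (1 : ℤ) ≤ Module.finrank K L := by exact_mod_cast hd
          linarith)
    rw [map_smul, smul_eq_mul, map_mul, hc, neg_add, add_comm, exp_add] at this
    exact (mul_le_mul_iff_right₀ exp_pos).1 this
  refine ⟨m - 1, h1, by rwa [sub_add_cancel], ?_⟩
  have h2 : ¬ P (m - 1) := fun h => by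
    have := hmin _ h
    omega
  rw [hP] at h2
  push Not at h2
  obtain ⟨y, hy, hy'⟩ := h2
  refine ⟨y, hy, le_antisymm (h1 y hy) ?_⟩
  by_contra! hlt
  rw [lt_exp_iff] at hlt
  exact hy'.not_ge (hlt.trans (exp_le_exp.2 (by omega)))

theorem exists_map_eq_prod_sub_one [IsGalois K L] (h : IsTotallyRamified v w)
    (hG : ∀ H : Subgroup (L ≃ₐ[K] L), H = ⊥ ∨ H = ⊤) {j : ℤ} (hj : 1 ≤ j) {p : L[X]}
    (hp : w.CoeffLE j p) :
    ∃ q : K[X], q.map (algebraMap K L) = ∏ σ : L ≃ₐ[K] L, (1 + σ • p) - 1 ∧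
      ∀ i, ∃ y, w y ≤ exp (-j) ∧ v (q.coeff i) ≤ max (exp (-j)) (v (Algebra.trace K L y)) := by
  classical
  have hd : 0 < Module.finrank K L := Module.finrank_pos
  have lift (P : L[X]) (hP : ∀ σ : L ≃ₐ[K] L, σ • P = P) :
      ∃ q : K[X], q.map (algebraMap K L) = P := by
    refine (Polynomial.mem_lifts P).1 ((Polynomial.lifts_iff_coeff_lifts P).2 fun i => ?_)
    refine (IsGalois.mem_range_algebraMap_iff_fixed _).2 fun σ => ?_
    have := congrArg (fun P => coeff P i) (hP σ)
    simpa using this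
  have hsmul (σ : L ≃ₐ[K] L) : w.CoeffLE j (σ • p) := fun i => by
    rw [Polynomial.coeff_smul, AlgEquiv.smul_def, h.map_algEquiv]
    exact hp i
  obtain ⟨q, hq⟩ := lift (∏ σ : L ≃ₐ[K] L, (1 + σ • p) - 1) (fun τ => by
    rw [smul_sub, smul_one, Finset.smul_prod']
    congr 1
    refine Fintype.prod_equiv (Equiv.mulLeft τ) _ _ fun σ => ?_
    simp [mul_smul])
  obtain ⟨r, hr⟩ := lift (∏ σ : L ≃ₐ[K] L, σ • p) (fun τ => by
    rw [Finset.smul_prod']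
    refine Fintype.prod_equiv (Equiv.mulLeft τ) _ _ fun σ => ?_
    simp [mul_smul])
  obtain ⟨R, hR, hprod⟩ := exists_prod_one_add_smul_eq hG p
  refine ⟨q, hq, fun i => ?_⟩
  set W : L[X] := ∑ I ∈ R, ∏ σ ∈ I, σ • p
  have hW : w.CoeffLE j W := CoeffLE.sum fun I hI =>
    (CoeffLE.prod fun σ _ => hsmul σ).mono (by
      have : 1 ≤ (I.card : ℤ) := by exact_mod_cast (hR I hI).card_pos
      nlinarith)
  refine ⟨W.coeff i, hW i, ?_⟩
  have hqi : q.coeff i = r.coeff i + Algebra.trace K L (W.coeff i) := by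
    apply (algebraMap K L).injective
    rw [map_add, ← coeff_map, ← coeff_map, hq, hr, hprod, trace_eq_sum_automorphisms]
    simp [finsetSum_coeff]
    ring
  rw [hqi]
  refine (v.map_add _ _).trans (max_le_max ?_ le_rfl)
  have hri : v (r.coeff i) ^ Module.finrank K L ≤ exp (-j) ^ Module.finrank K L := by
    rw [← h.map_algebraMap, ← coeff_map, hr, exp_pow, mul_neg]
    have := CoeffLE.prod (s := Finset.univ) (fun σ _ => hsmul σ) i
    rwa [Finset.card_univ, ← Nat.card_eq_fintype_card, IsGalois.card_aut_eq_finrank] at this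
  exact (pow_le_pow_iff_left₀ zero_le zero_le hd.ne').1 hri

theorem norm_eq_of_map_eq [IsGalois K L] {p : L[X]} {q : K[X]}
    (hq : q.map (algebraMap K L) = ∏ σ : L ≃ₐ[K] L, (1 + σ • p) - 1) (z : K) :
    Algebra.norm K (1 + p.eval (algebraMap K L z)) = 1 + q.eval z := by
  apply (algebraMap K L).injective
  rw [Algebra.norm_eq_prod_automorphisms, map_add (algebraMap K L), map_one (algebraMap K L),
    ← eval_map_apply, hq, eval_sub, eval_prod, eval_one, add_sub_cancel]
  refine Finset.prod_congr rfl fun σ _ => ?_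
  have : σ • algebraMap K L z = algebraMap K L z := by simp
  rw [map_add, map_one, eval_add, eval_one, ← this, Polynomial.smul_eval_smul, this,
    AlgEquiv.smul_def]

theorem coeff_one_prod_one_add_C_mul_X {ι R : Type*} [CommRing R] (s : Finset ι) (f : ι → R) :
    (∏ i ∈ s, (1 + C (f i) * X)).coeff 1 = ∑ i ∈ s, f i := by
  classical
  induction s using Finset.induction_on with
  | empty => simp [coeff_one]
  | insert a s ha ih =>
    have h0 : (∏ i ∈ s, (1 + C (f i) * X)).coeff 0 = 1 := by
      simp [coeff_zero_eq_eval_zero, eval_prod]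
    rw [Finset.prod_insert ha, Finset.sum_insert ha, add_mul, one_mul, coeff_add, ih, mul_assoc,
      coeff_C_mul, coeff_X_mul, h0, mul_one, add_comm]

theorem exists_normJump_of_simple [IsGalois K L] (h : IsTotallyRamified v w)
    (hG : ∀ H : Subgroup (L ≃ₐ[K] L), H = ⊥ ∨ H = ⊤) {n : ℤ} (hn : 1 ≤ n) :
    ∃ j, NormJump v w n j := by
  classical
  obtain ⟨J, hJ, hJ', y₀, hy₀, hy₀'⟩ := h.exists_trace_jump n
  have main (j m : ℤ) (hj : 1 ≤ j) (hmj : m ≤ j)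
      (hT : ∀ y, w y ≤ exp (-j) → v (Algebra.trace K L y) ≤ exp (-m)) (p : L[X])
      (hp : w.CoeffLE j p) : ∃ q : K[X],
        q.map (algebraMap K L) = ∏ σ : L ≃ₐ[K] L, (1 + σ • p) - 1 ∧ v.CoeffLE m q := by
    obtain ⟨q, hq, hq'⟩ := h.exists_map_eq_prod_sub_one hG hj hp
    refine ⟨q, hq, fun i => ?_⟩
    obtain ⟨y, hy, hy'⟩ := hq' i
    exact hy'.trans (max_le (exp_le_exp.2 (by omega)) (hT y hy))
  set j := max n J with hjdef
  have hnj : n ≤ j := le_max_left _ _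
  have hJj : J ≤ j := le_max_right _ _
  have hT1 : ∀ y, w y ≤ exp (-j) → v (Algebra.trace K L y) ≤ exp (-n) :=
    fun y hy => hJ y (hy.trans (exp_le_exp.2 (by omega)))
  have hT2 : ∀ y, w y ≤ exp (-(j + 1)) → v (Algebra.trace K L y) ≤ exp (-(n + 1)) :=
    fun y hy => hJ' y (hy.trans (exp_le_exp.2 (by omega)))
  have hsm (y : L) : ∏ σ : L ≃ₐ[K] L, (1 + σ • (C y * X) : L[X]) =
      ∏ σ : L ≃ₐ[K] L, (1 + C (σ y) * X) := by
    simp [smul_mul', Polynomial.smul_C]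
  refine ⟨j, by omega, ?_, ?_, ?_⟩
  · intro p hp
    obtain ⟨q, hq, hq'⟩ := main j n (by omega) hnj hT1 p hp
    exact ⟨q, hq', norm_eq_of_map_eq hq⟩
  · intro p hp
    obtain ⟨q, hq, hq'⟩ := main (j + 1) (n + 1) (by omega) (by omega) hT2 p hp
    exact ⟨q, hq', norm_eq_of_map_eq hq⟩
  · rcases le_total n J with hnJ | hnJ
    · have hjJ : j = J := max_eq_right hnJ
      obtain ⟨q, hq, hq'⟩ := main j n (by omega) hnj hT1 (C y₀ * X)
        (coeffLE_C_mul_X_iff.2 (hjJ ▸ hy₀))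
      refine ⟨y₀, ?_, q, hq', ⟨1, le_rfl, ?_⟩, fun z => ?_⟩
      · rw [hjJ]
        refine le_antisymm hy₀ ?_
        by_contra! hlt
        rw [lt_exp_iff] at hlt
        have := hJ' y₀ (hlt.trans (exp_le_exp.2 (by omega)))
        rw [hy₀', exp_le_exp] at this
        omega
      · rw [← hy₀']
        congr 1
        apply (algebraMap K L).injective
        rw [← coeff_map, hq, hsm, coeff_sub, coeff_one_prod_one_add_C_mul_X,
          trace_eq_sum_automorphisms]
        simp [coeff_one]
      · have := norm_eq_of_map_eq hq z
        rwa [eval_mul, eval_C, eval_X, mul_comm] at this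
    · have hjn : j = n := max_eq_left hnJ
      obtain ⟨y, hy⟩ := w.exists_map_eq_exp h.exists_uniformizer' (-j)
      obtain ⟨q, hq, hq'⟩ := main j n (by omega) hnj hT1 (C y * X)
        (coeffLE_C_mul_X_iff.2 hy.le)
      refine ⟨y, hy, q, hq', ⟨Module.finrank K L, Module.finrank_pos, ?_⟩, fun z => ?_⟩
      · rw [← hjn, ← hy, ← h.map_norm]
        congr 1
        apply (algebraMap K L).injective
        have hcard : Fintype.card (L ≃ₐ[K] L) = Module.finrank K L := by
          rw [← Nat.card_eq_fintype_card, IsGalois.card_aut_eq_finrank]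
        have := Polynomial.coeff_prod_of_natDegree_le (Finset.univ : Finset (L ≃ₐ[K] L))
          (fun σ => 1 + C (σ y) * X) 1 (fun σ _ => by compute_degree)
        rw [mul_one, Finset.card_univ, hcard] at this
        rw [← coeff_map, hq, hsm, coeff_sub, this, Algebra.norm_eq_prod_automorphisms]
        have h0 : Module.finrank K L ≠ 0 := Module.finrank_pos.ne'
        simp [coeff_one, h0]
      · have := norm_eq_of_map_eq hq z
        rwa [eval_mul, eval_C, eval_X, mul_comm] at this

end IsTotallyRamified

end Valuation

namespace Valuation

section Comp

variable {K : Type*} [Field K] {v : Valuation K Γ₀}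

theorem CoeffLE.exists_eq_C_mul_map {k : ℤ} {p : K[X]} (hp : v.CoeffLE k p) {c : K}
    (hc : v c = exp (-k)) :
    ∃ P : v.valuationSubring[X], p = C c * P.map (algebraMap v.valuationSubring K) ∧
      ∀ i, v (p.coeff i) = exp (-k) ↔
        (P.map (IsLocalRing.residue v.valuationSubring)).coeff i ≠ 0 := by
  have hc0 : c ≠ 0 := by
    rw [← v.ne_zero_iff, hc]
    exact exp_ne_zero
  have hle (i : ℕ) : v (c⁻¹ * p.coeff i) ≤ 1 := by
    rw [map_mul, map_inv₀, hc]
    calc _ ≤ (exp (-k) : Γ₀)⁻¹ * exp (-k) := by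
          gcongr
          exact hp i
      _ = 1 := inv_mul_cancel₀ exp_ne_zero
  obtain ⟨P, hP⟩ : ∃ P : v.valuationSubring[X],
      P.map (algebraMap v.valuationSubring K) = C c⁻¹ * p := by
    refine (Polynomial.mem_lifts _).1 ((Polynomial.lifts_iff_coeff_lifts _).2 fun i => ?_)
    rw [coeff_C_mul]
    exact ⟨⟨_, (v.mem_valuationSubring_iff _).2 (hle i)⟩, rfl⟩
  refine ⟨P, by rw [hP, ← mul_assoc, ← C_mul, mul_inv_cancel₀ hc0, C_1, one_mul], fun i => ?_⟩
  have hi : algebraMap v.valuationSubring K (P.coeff i) = c⁻¹ * p.coeff i := by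
    rw [← coeff_map, hP, coeff_C_mul]
  rw [coeff_map, Ne, IsLocalRing.residue_eq_zero_iff, IsLocalRing.mem_maximalIdeal, mem_nonunits_iff,
    not_not, (v.valuationSubring).valuation_eq_one_iff]
  have h1 : v.valuationSubring.valuation ((P.coeff i : v.valuationSubring) : K) = 1 ↔
      v ((P.coeff i : v.valuationSubring) : K) = 1 :=
    (v.isEquiv_valuation_valuationSubring.eq_one_iff_eq_one).symm
  rw [h1]
  have h2 : ((P.coeff i : v.valuationSubring) : K) = c⁻¹ * p.coeff i := hi
  rw [h2, map_mul, map_inv₀, hc, inv_mul_eq_one₀ exp_ne_zero, eq_comm]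

theorem CoeffLE.comp {k : ℤ} {p q : K[X]} (hp : v.CoeffLE k p) (hq : v.CoeffLE 0 q)
    (hv : ∃ π : K, v π = exp (-1))
    (hp' : ∃ i, 1 ≤ i ∧ v (p.coeff i) = exp (-k)) (hq' : ∃ i, 1 ≤ i ∧ v (q.coeff i) = 1) :
    v.CoeffLE k (p.comp q) ∧ ∃ i, 1 ≤ i ∧ v ((p.comp q).coeff i) = exp (-k) := by
  obtain ⟨c, hc⟩ := v.exists_map_eq_exp hv (-k)
  obtain ⟨P, hP, hP'⟩ := hp.exists_eq_C_mul_map hc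
  obtain ⟨Q, hQ, hQ'⟩ := hq.exists_eq_C_mul_map (c := 1) (by simp)
  rw [C_1, one_mul] at hQ
  have hcomp : p.comp q = C c * (P.comp Q).map (algebraMap v.valuationSubring K) := by
    rw [hP, hQ, Polynomial.map_comp, mul_comp, C_comp]
  have hle : v.CoeffLE k (p.comp q) := fun i => by
    rw [hcomp, coeff_C_mul, map_mul, hc, coeff_map]
    exact mul_le_of_le_one_right' ((v.mem_valuationSubring_iff _).1 ((P.comp Q).coeff i).2)
  refine ⟨hle, ?_⟩
  have key (S : v.valuationSubring[X])
      (hS : ∃ i, 1 ≤ i ∧ (S.map (IsLocalRing.residue v.valuationSubring)).coeff i ≠ 0) :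
      (S.map (IsLocalRing.residue v.valuationSubring)).natDegree ≠ 0 := by
    obtain ⟨i, hi, hi'⟩ := hS
    have := le_natDegree_of_ne_zero hi'
    omega
  have hPd := key P (by
    obtain ⟨i, hi, hi'⟩ := hp'
    exact ⟨i, hi, (hP' i).1 hi'⟩)
  have hQd := key Q (by
    obtain ⟨i, hi, hi'⟩ := hq'
    exact ⟨i, hi, (hQ' i).1 (by simpa using hi')⟩)
  set i := ((P.comp Q).map (IsLocalRing.residue v.valuationSubring)).natDegree with hidef
  have hi : i ≠ 0 := by
    rw [hidef, Polynomial.map_comp, natDegree_comp]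
    exact mul_ne_zero hPd hQd
  refine ⟨i, by omega, ?_⟩
  have h0 : ((P.comp Q).map (IsLocalRing.residue v.valuationSubring)).coeff i ≠ 0 := by
    rw [hidef, coeff_natDegree]
    exact leadingCoeff_ne_zero.2 (ne_zero_of_natDegree_gt (Nat.pos_of_ne_zero hi))
  obtain ⟨S, hS, hS'⟩ := hle.exists_eq_C_mul_map hc
  have hSS : S = P.comp Q := by
    have hc0 : c ≠ 0 := by
      rw [← v.ne_zero_iff, hc]
      exact exp_ne_zero
    have := mul_left_cancel₀ (C_ne_zero.2 hc0) (hS.symm.trans hcomp)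
    exact Polynomial.map_injective _ Subtype.val_injective this
  exact (hS' i).2 (hSS ▸ h0)

end Comp

namespace IsTotallyRamified

variable {K M : Type*} [Field K] [Field M] [Algebra K M] [FiniteDimensional K M]
  {v : Valuation K Γ₀} {w : Valuation M Γ₀}

/-- A totally ramified extension does not change the residue field. -/
theorem exists_sub_lt_one (h : IsTotallyRamified v w) {x : M} (hx : w x ≤ 1) :
    ∃ a : K, v a ≤ 1 ∧ w (x - algebraMap K M a) < 1 := by
  obtain ⟨ϖ, hϖ⟩ := h.exists_uniformizer'
  have hd : 0 < Module.finrank K M := Module.finrank_pos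
  let i₀ : Fin (Module.finrank K M) := ⟨0, hd⟩
  refine ⟨(h.basis hϖ).repr x i₀, h.repr_le_one hϖ hx i₀, ?_⟩
  have hs := h.sum_repr hϖ x
  rw [← Finset.add_sum_erase _ _ (Finset.mem_univ i₀)] at hs
  have : x - algebraMap K M ((h.basis hϖ).repr x i₀) =
      ∑ i ∈ Finset.univ.erase i₀, (h.basis hϖ).repr x i • ϖ ^ (i : ℕ) := by
    rw [sub_eq_iff_eq_add, add_comm, Algebra.algebraMap_eq_smul_one]
    simpa only [i₀, pow_zero] using hs.symm
  rw [this]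
  refine w.map_sum_lt one_ne_zero fun i hi => ?_
  have hi0 : (i : ℕ) ≠ 0 := fun h0 => (Finset.mem_erase.1 hi).1 (Fin.ext h0)
  rw [Algebra.smul_def, map_mul, h.map_algebraMap, map_pow, hϖ, exp_pow]
  calc _ ≤ (1 : Γ₀) * exp ((i : ℕ) * (-1) : ℤ) := by
        gcongr
        exact pow_le_one₀ zero_le (h.repr_le_one hϖ hx i)
    _ < 1 := by
      rw [one_mul, ← exp_zero, exp_lt_exp]
      omega

theorem exists_polynomial_approx (h : IsTotallyRamified v w) {m : ℤ} {y : M}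
    (hy : w y = exp (-m)) {r : M[X]} (hr : w.CoeffLE m r) :
    ∃ q : K[X], v.CoeffLE 0 q ∧ w.CoeffLE (m + 1) (r - C y * q.map (algebraMap K M)) := by
  have hy0 : y ≠ 0 := by
    rw [← w.ne_zero_iff, hy]
    exact exp_ne_zero
  have (i : ℕ) : ∃ a : K, v a ≤ 1 ∧ w (r.coeff i - y * algebraMap K M a) ≤ exp (-(m + 1)) := by
    obtain ⟨a, ha, ha'⟩ := h.exists_sub_lt_one (x := y⁻¹ * r.coeff i) (by
      rw [map_mul, map_inv₀, hy]
      calc _ ≤ (exp (-m) : Γ₀)⁻¹ * exp (-m) := by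
            gcongr
            exact hr i
        _ = 1 := inv_mul_cancel₀ exp_ne_zero)
    refine ⟨a, ha, ?_⟩
    have h1 : r.coeff i - y * algebraMap K M a = y * (y⁻¹ * r.coeff i - algebraMap K M a) := by
      field_simp
    rw [← exp_zero, lt_exp_iff] at ha'
    rw [h1, map_mul, hy, neg_add, exp_add]
    gcongr
    exact ha'
  choose a ha ha' using this
  refine ⟨∑ i ∈ Finset.range (r.natDegree + 1), C (a i) * X ^ i, ?_, ?_⟩
  · intro i
    rw [finsetSum_coeff]
    simp only [coeff_C_mul_X_pow, Finset.sum_ite_eq, Finset.mem_range]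
    split_ifs
    · simpa using ha i
    · simp
  · intro i
    rw [coeff_sub, coeff_C_mul, coeff_map, finsetSum_coeff]
    simp only [coeff_C_mul_X_pow, Finset.sum_ite_eq, Finset.mem_range]
    split_ifs with hi
    · exact ha' i
    · rw [coeff_eq_zero_of_natDegree_lt (by omega)]
      simp

end IsTotallyRamified

theorem NormJump.trans {K M L : Type*} [Field K] [Field M] [Field L] [Algebra K M] [Algebra M L]
    [Algebra K L] [IsScalarTower K M L] [FiniteDimensional K M] [FiniteDimensional M L]
    {v : Valuation K Γ₀} {vM : Valuation M Γ₀} {w : Valuation L Γ₀}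
    (h : IsTotallyRamified v vM) {n m j : ℤ} (hn : 1 ≤ n) (h₁ : NormJump v vM n m)
    (h₂ : NormJump vM w m j) : NormJump v w n j := by
  have hm := h₁.one_le
  refine ⟨h₂.one_le, ?_, ?_, ?_⟩
  · intro p hp
    obtain ⟨r, hr, hr'⟩ := h₂.exists_norm_eq p hp
    obtain ⟨q, hq, hq'⟩ := h₁.exists_norm_eq r hr
    refine ⟨q, hq, fun z => ?_⟩
    rw [← hq', ← hr', Algebra.norm_norm, IsScalarTower.algebraMap_apply K M L]
  · intro p hp
    obtain ⟨r, hr, hr'⟩ := h₂.exists_norm_eq_succ p hp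
    obtain ⟨q, hq, hq'⟩ := h₁.exists_norm_eq_succ r hr
    refine ⟨q, hq, fun z => ?_⟩
    rw [← hq', ← hr', Algebra.norm_norm, IsScalarTower.algebraMap_apply K M L]
  · obtain ⟨y, hy, r, hr, ⟨i, hi, hri⟩, hr'⟩ := h₂.exists_nonconstant
    obtain ⟨yM, hyM, qM, hqM, hqM', hnorm⟩ := h₁.exists_nonconstant
    obtain ⟨q, hq, hR⟩ := h.exists_polynomial_approx hyM hr
    have hqi : v (q.coeff i) = 1 := by
      refine le_antisymm (by simpa using hq i) ?_
      by_contra! hlt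
      have h1 := hR i
      have h2 : vM (C yM * q.map (algebraMap K M)|>.coeff i) < exp (-m) := by
        rw [coeff_C_mul, coeff_map, map_mul, hyM, h.map_algebraMap]
        exact mul_lt_of_lt_one_right exp_pos (pow_lt_one₀ zero_le hlt Module.finrank_pos.ne')
      have h3 : vM ((r - C yM * q.map (algebraMap K M)).coeff i +
          (C yM * q.map (algebraMap K M)).coeff i) < exp (-m) :=
        vM.map_add_lt (h1.trans_lt (exp_lt_exp.2 (by omega))) h2
      rw [coeff_sub, sub_add_cancel, hri] at h3
      exact lt_irrefl _ h3
    obtain ⟨ht, k, hk, htk⟩ := hqM.comp hq h.exists_uniformizer hqM' ⟨i, hi, hqi⟩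
    set t := qM.comp q
    set A : M[X] := C yM * q.map (algebraMap K M) with hA
    have hAm : vM.CoeffLE m A := fun i => by
      rw [hA, coeff_C_mul, coeff_map, map_mul, hyM, h.map_algebraMap]
      refine mul_le_of_le_one_right' (pow_le_one₀ zero_le ?_)
      simpa using hq i
    have hevA (z : K) : A.eval (algebraMap K M z) = algebraMap K M (q.eval z) * yM := by
      rw [hA, eval_mul, eval_C, eval_map_apply, mul_comm]
    obtain ⟨s, hs, hs'⟩ := h₁.exists_norm_eq r hr
    obtain ⟨a, ha, ha'⟩ := h₁.exists_norm_eq (-A) hAm.neg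
    obtain ⟨b₁, hb₁, hb₁'⟩ := h₁.exists_norm_eq_succ (r - A - r * A)
      (hR.sub ((hr.mul hAm).mono (by omega)))
    obtain ⟨b₂, hb₂, hb₂'⟩ := h₁.exists_norm_eq_succ (-(A * A))
      ((hAm.mul hAm).mono (by omega)).neg
    have := v.infinite_of_uniformizer h.exists_uniformizer
    have e₁ : (1 + s) * (1 + a) = 1 + b₁ := Polynomial.funext fun z => by
      simp only [eval_mul, eval_add, eval_one]
      rw [← hs', ← ha', ← hb₁', ← map_mul]
      congr 1
      simp only [eval_mul, eval_sub, eval_neg]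
      ring
    have e₂ : (1 + t) * (1 + a) = 1 + b₂ := Polynomial.funext fun z => by
      simp only [eval_mul, eval_add, eval_one]
      rw [← ha', ← hb₂', show t.eval z = qM.eval (q.eval z) from eval_comp, ← hnorm, ← map_mul]
      congr 1
      simp only [eval_mul, eval_neg, hevA]
      ring
    have hst : v.CoeffLE (n + 1) (s - t) := by
      have : s - t = (b₁ - b₂) - (s - t) * a := by linear_combination e₁ - e₂
      rw [this]
      exact (hb₁.sub hb₂).sub (((hs.sub ht).mul ha).mono (by omega))
    refine ⟨y, hy, s, hs, ⟨k, hk, ?_⟩, fun z => ?_⟩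
    · have h1 : s.coeff k = t.coeff k + (s - t).coeff k := by
        rw [coeff_sub]
        ring
      rw [h1, v.map_add_eq_of_lt_left, htk]
      rw [htk]
      exact (hst k).trans_lt (exp_lt_exp.2 (by omega))
    · rw [← hs', ← hr', Algebra.norm_norm, IsScalarTower.algebraMap_apply K M L]

end Valuation

namespace Valuation

namespace IsTotallyRamified

variable {K : Type*} {L : Type*} [Field K] [Field L] [Algebra K L] [FiniteDimensional K L]
  {v : Valuation K Γ₀} {w : Valuation L Γ₀}

/-- An intermediate field of a totally ramified Galois extension is totally ramified over the
base, and the big field is totally ramified over it. -/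
theorem exists_intermediate [IsGalois K L] (h : IsTotallyRamified v w) (M : Type*) [Field M]
    [Algebra K M] [Algebra M L] [IsScalarTower K M L] [FiniteDimensional K M]
    [FiniteDimensional M L] :
    ∃ vM : Valuation M Γ₀, IsTotallyRamified v vM ∧ IsTotallyRamified vM w := by
  have he : Module.finrank M L ≠ 0 := Module.finrank_pos.ne'
  have key (x : M) : w (algebraMap M L x) = v (Algebra.norm K x) ^ Module.finrank M L := by
    rw [← h.map_norm, ← Algebra.norm_norm (S := M), Algebra.norm_algebraMap, map_pow, map_pow]
  let vM : Valuation M Γ₀ :=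
    { toFun := fun x => v (Algebra.norm K x)
      map_zero' := by simp [Algebra.norm_zero]
      map_one' := by simp
      map_mul' := fun x y => by simp
      map_add_le_max' := fun x y => by
        rw [← pow_le_pow_iff_left₀ zero_le zero_le he, ← key, map_add]
        refine (w.map_add _ _).trans ?_
        rw [key, key]
        rcases le_total (v (Algebra.norm K x)) (v (Algebra.norm K y)) with hxy | hxy
        · rw [max_eq_right hxy, max_eq_right (pow_le_pow_left₀ zero_le hxy _)]
        · rw [max_eq_left hxy, max_eq_left (pow_le_pow_left₀ zero_le hxy _)] }
  have hvM (x : M) : vM x = v (Algebra.norm K x) := rfl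
  obtain ⟨π, hπ⟩ := h.exists_uniformizer'
  have hu : ∃ π : M, vM π = exp (-1) :=
    ⟨Algebra.norm M π, by rw [hvM, Algebra.norm_norm, h.map_norm, hπ]⟩
  refine ⟨vM, ⟨h.exists_uniformizer, hu, fun x => ?_⟩, ⟨hu, h.exists_uniformizer', key⟩⟩
  rw [hvM, Algebra.norm_algebraMap, map_pow]

end IsTotallyRamified

theorem IsTotallyRamified.exists_normJump.{u, u'} (d : ℕ) :
    ∀ {K : Type u} {L : Type u'} [Field K] [Field L] [Algebra K L] [FiniteDimensional K L]
      [IsGalois K L] {v : Valuation K Γ₀} {w : Valuation L Γ₀} (_ : IsTotallyRamified v w)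
      (_ : ∀ σ τ : L ≃ₐ[K] L, σ * τ = τ * σ) (_ : Module.finrank K L ≤ d) {n : ℤ} (_ : 1 ≤ n),
      ∃ j, NormJump v w n j := by
  induction d with
  | zero =>
    intro K L _ _ _ _ _ v w _ _ hd
    have : 0 < Module.finrank K L := Module.finrank_pos
    omega
  | succ d ih =>
    intro K L _ _ _ _ _ v w h hab hd n hn
    rcases eq_or_ne (Nat.card (L ≃ₐ[K] L)) 1 with h1 | h1
    · have := (Nat.card_eq_one_iff_unique.1 h1).1
      exact h.exists_normJump_of_simple (fun H => Or.inl (Subsingleton.elim _ _)) hn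
    obtain ⟨p, hp, hdvd⟩ := Nat.exists_prime_and_dvd h1
    have : Fact p.Prime := ⟨hp⟩
    obtain ⟨g, hg⟩ := exists_prime_orderOf_dvd_card' p hdvd
    set H := Subgroup.zpowers g
    have hH : Nat.card H = p := by rw [Nat.card_zpowers, hg]
    have : H.Normal := ⟨fun a ha b => by rwa [hab b a, mul_inv_cancel_right]⟩
    let M := IntermediateField.fixedField H
    have : IsGalois K M := IsGalois.of_fixedField_normal_subgroup H
    obtain ⟨vM, hv, hw⟩ := h.exists_intermediate M
    have hcard : Module.finrank M L = p := by
      rw [← hH]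
      exact IntermediateField.finrank_fixedField_eq_card H
    have hmul : Module.finrank K M * Module.finrank M L = Module.finrank K L :=
      Module.finrank_mul_finrank K M L
    have h2 := hp.two_le
    have h3 : 0 < Module.finrank K M := Module.finrank_pos
    obtain ⟨m, hm⟩ := ih hv (fun σ τ => by
      obtain ⟨σ, rfl⟩ := AlgEquiv.restrictNormalHom_surjective (F := K) (K₁ := M) (E := L) σ
      obtain ⟨τ, rfl⟩ := AlgEquiv.restrictNormalHom_surjective (F := K) (K₁ := M) (E := L) τ
      rw [← map_mul, hab, map_mul]) (by nlinarith) hn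
    have : Fact (Nat.card (L ≃ₐ[M] L)).Prime := ⟨by
      rw [IsGalois.card_aut_eq_finrank, hcard]
      exact hp⟩
    obtain ⟨j, hj⟩ := hw.exists_normJump_of_simple
      (fun H => H.eq_bot_or_eq_top_of_prime_card) hm.one_le
    exact ⟨j, hm.trans hv hn hj⟩

end Valuation

end Valuations

section NormLike

open Polynomial IsLocalRing

universe u

/-- A finite free module over an adically complete ring is adically complete. -/
theorem IsPrecomplete.of_basis {R M ι : Type*} [CommRing R] [AddCommGroup M] [Module R M]
    [Finite ι] (b : Module.Basis ι R M) (I : Ideal R) [IsPrecomplete I R] :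
    IsPrecomplete I M := by
  have := Fintype.ofFinite ι
  refine ⟨fun f hf => ?_⟩
  have hc (i : ι) : ∃ L : R, ∀ n, b.coord i (f n) ≡ L [SMOD (I ^ n • ⊤ : Submodule R R)] := by
    refine IsPrecomplete.prec inferInstance fun {m n} hmn => ?_
    refine ((hf hmn).map (b.coord i)).mono ?_
    rw [Submodule.map_smul'']
    exact Submodule.smul_mono le_rfl le_top
  choose L hL using hc
  refine ⟨∑ i, L i • b i, fun n => ?_⟩
  rw [SModEq.sub_mem]
  nth_rewrite 1 [← b.sum_repr (f n)]
  rw [← Finset.sum_sub_distrib]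
  refine Submodule.sum_mem _ fun i _ => ?_
  rw [← sub_smul]
  refine Submodule.smul_mem_smul ?_ Submodule.mem_top
  simpa [SModEq.sub_mem] using hL i n

/-- A finite extension `B` of a discrete valuation ring is a discrete valuation ring with
uniformizer `b` if `b` generates a maximal ideal and a power of `b` is divisible by a uniformizer
of the base. -/
theorem IsDiscreteValuationRing.of_finite {A B : Type*} [CommRing A] [IsDomain A]
    [IsDiscreteValuationRing A] [CommRing B] [IsDomain B] [Algebra A B] [Module.Finite A B]
    {ϖ : A} (hϖ : Irreducible ϖ) {b : B}
    (hb : (Ideal.span {b}).IsMaximal) (hb0 : b ≠ 0) {k : ℕ} (hk : algebraMap A B ϖ ∣ b ^ k) :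
    IsDiscreteValuationRing B ∧ Irreducible b := by
  have hAB : Algebra.IsIntegral A B := inferInstance
  have huniq (P : Ideal B) (hP : P.IsMaximal) : P = Ideal.span {b} := by
    have h1 : (P.comap (algebraMap A B)).IsMaximal :=
      Ideal.isMaximal_comap_of_isIntegral_of_isMaximal P
    have h2 : ϖ ∈ P.comap (algebraMap A B) := by
      rw [IsLocalRing.eq_maximalIdeal h1, mem_maximalIdeal]
      exact hϖ.not_isUnit
    have h3 : b ∈ P := hP.isPrime.mem_of_pow_mem k (P.mem_of_dvd hk h2)
    exact (hb.eq_of_le hP.ne_top ((Ideal.span_singleton_le_iff_mem P).2 h3)).symm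
  have hloc : IsLocalRing B := IsLocalRing.of_unique_max_ideal ⟨_, hb, huniq⟩
  have hnoeth : IsNoetherianRing B := IsNoetherianRing.of_finite A B
  have hmax : IsLocalRing.maximalIdeal B = Ideal.span {b} := 
    huniq _ (IsLocalRing.maximalIdeal.isMaximal B)
  have hfield : ¬ IsField B := fun h => by
    rw [IsLocalRing.isField_iff_maximalIdeal_eq] at h
    exact hb0 (Ideal.span_singleton_eq_bot.1 (hmax ▸ h))
  have hprin : (IsLocalRing.maximalIdeal B).IsPrincipal := ⟨⟨b, hmax⟩⟩
  refine ⟨((IsDiscreteValuationRing.TFAE B hfield).out 0 4).2 hprin, ?_⟩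
  exact ((Ideal.span_singleton_prime hb0).1 hb.isPrime).irreducible

/-- The extension `R'/R` of discrete valuation rings is finite of ramification index one. -/
structure IsFiniteUnramified (R R' : Type*) [CommRing R] [CommRing R'] [Algebra R R'] : Prop where
  finite : Module.Finite R R'
  injective : Function.Injective (algebraMap R R')
  irreducible : ∀ ϖ : R, Irreducible ϖ → Irreducible (algebraMap R R' ϖ)

theorem IsFiniteUnramified.refl (R : Type*) [CommRing R] : IsFiniteUnramified R R :=
  ⟨inferInstance, Function.injective_id, fun _ h => h⟩

theorem IsFiniteUnramified.trans {R R₁ R₂ : Type*} [CommRing R] [CommRing R₁] [CommRing R₂]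
    [Algebra R R₁] [Algebra R₁ R₂] [Algebra R R₂] [IsScalarTower R R₁ R₂]
    (h₁ : IsFiniteUnramified R R₁) (h₂ : IsFiniteUnramified R₁ R₂) : IsFiniteUnramified R R₂ := by
  have := h₁.finite
  have := h₂.finite
  refine ⟨Module.Finite.trans R₁ R₂, ?_, fun ϖ hϖ => ?_⟩
  · rw [IsScalarTower.algebraMap_eq R R₁ R₂]
    exact h₂.injective.comp h₁.injective
  · rw [IsScalarTower.algebraMap_apply R R₁ R₂]
    exact h₂.irreducible _ (h₁.irreducible _ hϖ)

section

variable {R : Type u} [CommRing R] [IsDomain R] [IsDiscreteValuationRing R]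

/-- Adjoining a root of a monic polynomial that is irreducible over the residue field. -/
theorem isFiniteUnramified_adjoinRoot {f : R[X]} (hf : f.Monic)
    (hirr : Irreducible (f.map (residue R))) :
    ∃ _ : IsDomain (AdjoinRoot f), IsDiscreteValuationRing (AdjoinRoot f) ∧
      IsFiniteUnramified R (AdjoinRoot f) := by
  have hfi : Irreducible f := hf.irreducible_of_irreducible_map _ _ hirr
  have hdom : IsDomain (AdjoinRoot f) := AdjoinRoot.isDomain_of_prime hfi.prime
  have hfin : Module.Finite R (AdjoinRoot f) := hf.finite_adjoinRoot
  have hfree : Module.Free R (AdjoinRoot f) := hf.free_adjoinRoot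
  have hinj : Function.Injective (algebraMap R (AdjoinRoot f)) := FaithfulSMul.algebraMap_injective _ _
  obtain ⟨ϖ₀, hϖ₀⟩ := IsDiscreteValuationRing.exists_irreducible R
  have key (ϖ : R) (hϖ : Irreducible ϖ) :
      (Ideal.span {algebraMap R (AdjoinRoot f) ϖ}).IsMaximal := by
    have e := AdjoinRoot.quotAdjoinRootEquivQuotPolynomialQuot (maximalIdeal R) f
    have h1 : (maximalIdeal R).map (AdjoinRoot.of f) =
        Ideal.span {algebraMap R (AdjoinRoot f) ϖ} := by
      rw [hϖ.maximalIdeal_eq, Ideal.map_span, Set.image_singleton]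
      rfl
    rw [← h1]
    refine Ideal.Quotient.maximal_of_isField _ ?_
    refine e.toMulEquiv.isField ?_
    have : (Ideal.span {f.map (Ideal.Quotient.mk (maximalIdeal R))}).IsMaximal :=
      PrincipalIdealRing.isMaximal_of_irreducible (R := (ResidueField R)[X]) hirr
    exact (Ideal.Quotient.maximal_ideal_iff_isField_quotient _).1 this
  have h2 (ϖ : R) (hϖ : Irreducible ϖ) :=
    IsDiscreteValuationRing.of_finite hϖ (key ϖ hϖ)
      ((map_ne_zero_iff _ hinj).2 hϖ.ne_zero) (k := 1) (by simp)
  exact ⟨hdom, (h2 _ hϖ₀).1, hfin, hinj, fun ϖ hϖ => (h2 ϖ hϖ).2⟩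

theorem IsFiniteUnramified.isAdicComplete [IsAdicComplete (maximalIdeal R) R] {R' : Type*}
    [CommRing R'] [IsDomain R'] [IsDiscreteValuationRing R'] [Algebra R R']
    (h : IsFiniteUnramified R R') : IsAdicComplete (maximalIdeal R') R' := by
  have := h.finite
  have : FaithfulSMul R R' := (faithfulSMul_iff_algebraMap_injective R R').2 h.injective
  have : Module.IsTorsionFree R R' := inferInstance
  have : Module.Free R R' := inferInstance
  have hp : IsPrecomplete (maximalIdeal R) R' :=
    IsPrecomplete.of_basis (Module.Free.chooseBasis R R') _
  obtain ⟨ϖ, hϖ⟩ := IsDiscreteValuationRing.exists_irreducible R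
  have h1 : maximalIdeal R' = (maximalIdeal R).map (algebraMap R R') := by
    rw [(h.irreducible ϖ hϖ).maximalIdeal_eq, hϖ.maximalIdeal_eq, Ideal.map_span,
      Set.image_singleton]
  rw [h1, IsAdicComplete.map_algebraMap_iff]
  exact { toIsHausdorff := inferInstance, toIsPrecomplete := hp }

theorem IsFiniteUnramified.exists_dvd_aeval_sub [IsAdicComplete (maximalIdeal R) R] {ϖ : R}
    (hϖ : Irreducible ϖ) {Q : R[X]} {i : ℕ} (hi : 1 ≤ i) (hQ : IsUnit (Q.coeff i)) (c : R) :
    ∃ (R' : Type u) (_ : CommRing R') (_ : IsDomain R') (_ : IsDiscreteValuationRing R')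
      (_ : IsAdicComplete (maximalIdeal R') R') (_ : Algebra R R'), IsFiniteUnramified R R' ∧
      ∃ z : R', algebraMap R R' ϖ ∣ aeval z Q - algebraMap R R' c := by
  set P := (Q - C c).map (residue R) with hP
  have hPi : P.coeff i ≠ 0 := by
    rw [hP, coeff_map, coeff_sub, coeff_C, if_neg (by omega), sub_zero]
    exact (hQ.map (residue R)).ne_zero
  have hPu : ¬ IsUnit P := by
    intro hu
    have := natDegree_eq_zero_of_isUnit hu
    have := le_natDegree_of_ne_zero hPi
    omega
  obtain ⟨p, hpm, hp, hpd⟩ := Polynomial.exists_monic_irreducible_factor P hPu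
  obtain ⟨f, hf, -, hfm⟩ := lifts_and_natDegree_eq_and_monic (f := residue R) (p := p) (by
    rw [Polynomial.mem_lifts]
    exact Polynomial.map_surjective _ residue_surjective p) hpm
  obtain ⟨h1, h2, h3⟩ := isFiniteUnramified_adjoinRoot hfm (hf ▸ hp)
  refine ⟨AdjoinRoot f, inferInstance, h1, h2, h3.isAdicComplete, inferInstance, h3,
    AdjoinRoot.root f, ?_⟩
  obtain ⟨q, hq⟩ := hpd
  obtain ⟨q, rfl⟩ := Polynomial.map_surjective _ residue_surjective q
  have hdiff (j : ℕ) : ϖ ∣ (Q - C c - f * q).coeff j := by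
    rw [← Ideal.mem_span_singleton, ← hϖ.maximalIdeal_eq, ← residue_eq_zero_iff, ← coeff_map,
      Polynomial.map_sub, ← hP, hq, Polynomial.map_mul, hf, sub_self, coeff_zero]
  obtain ⟨S, hS⟩ := (Polynomial.C_dvd_iff_dvd_coeff ϖ _).2 hdiff
  have := congrArg (aeval (AdjoinRoot.root f)) hS
  simp only [map_sub, map_mul, aeval_C, AdjoinRoot.aeval_eq, AdjoinRoot.mk_self, zero_mul,
    sub_zero] at this
  rw [AdjoinRoot.aeval_eq, this]
  exact dvd_mul_right _ _

/-- Hensel's lemma for polynomials `a + X + X ^ 2 * g`, monic or not. -/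
theorem HenselianRing.exists_add_add_eq_zero {R : Type*} [CommRing R] [IsLocalRing R]
    [HenselianRing R (maximalIdeal R)] {a : R} (ha : a ∈ maximalIdeal R) (g : R[X]) :
    ∃ x, a + x + x ^ 2 * g.eval x = 0 := by
  set E := (g.comp (C a * X)).reverse with hE
  set e := (g.comp (C a * X)).natDegree with he
  have hEe : E.natDegree ≤ e := reverse_natDegree_le _
  have hmonic : (X ^ (e + 2) + (X ^ (e + 1) + C a * E)).Monic := by
    refine monic_X_pow_add ?_
    refine (degree_le_of_natDegree_le (n := e + 1) ?_).trans_lt (by exact_mod_cast Nat.lt_succ_self _)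
    refine natDegree_add_le_of_degree_le (by simp) ?_
    exact (natDegree_C_mul_le _ _).trans (by omega)
  obtain ⟨y, hy, hy1⟩ := HenselianRing.is_henselian (I := maximalIdeal R) _ hmonic (-1) (by
      have : eval (-1) (X ^ (e + 2) + (X ^ (e + 1) + C a * E)) = a * eval (-1) E := by
        simp
        ring
      rw [this]
      exact Ideal.mul_mem_right _ _ ha) (by
      have : eval (-1) (derivative (X ^ (e + 2) + (X ^ (e + 1) + C a * E))) =
          (-1) ^ (e + 1) + a * eval (-1) (derivative E) := by
        simp
        ring
      rw [this, map_add, map_mul, Ideal.Quotient.eq_zero_iff_mem.2 ha, zero_mul, add_zero]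
      exact (isUnit_neg_one.pow _).map _)
  have hyu : IsUnit y := by
    by_contra hyn
    rw [← mem_nonunits_iff, ← mem_maximalIdeal] at hyn
    have := (maximalIdeal R).sub_mem hy1 hyn
    simp [mem_maximalIdeal] at this
  obtain ⟨y, rfl⟩ := hyu
  refine ⟨a * ↑y⁻¹, ?_⟩
  have hr : eval (y : R) E = y ^ e * g.eval (a * ↑y⁻¹) := by
    let := (y⁻¹).invertible
    have := eval₂_reverse_mul_pow (RingHom.id R) (↑y⁻¹ : R) (g.comp (C a * X))
    have hinv : (⅟(↑y⁻¹ : R)) = y := by simp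
    rw [hinv, ← hE, ← he] at this
    simp only [eval₂_id, eval_comp, eval_mul, eval_C, eval_X] at this
    rw [← this, mul_comm, mul_assoc, ← mul_pow]
    simp
  have h0 := hy.eq_zero
  simp only [eval_add, eval_mul, eval_C, eval_pow, eval_X, hr] at h0
  have hyy : (y : R) * ↑y⁻¹ = 1 := by simp
  have h1 : (y : R) ^ 2 + y + a * g.eval (a * ↑y⁻¹) = 0 := by
    refine (IsUnit.mul_right_eq_zero (y.isUnit.pow e)).1 ?_
    linear_combination h0
  linear_combination a * ↑y⁻¹ ^ 2 * h1 - (a * (y * ↑y⁻¹ + 1) + a * ↑y⁻¹) * hyy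

end

/-- The multiplicative monoid generated by the values in `R'` of the polynomials in `S`. -/
def valueMonoid {R : Type*} [CommRing R] (S : Set R[X]) (R' : Type*) [CommRing R'] [Algebra R R'] :
    Submonoid R' :=
  Submonoid.closure {x | ∃ p ∈ S, ∃ z : R', aeval z p = x}

theorem aeval_mem_valueMonoid {R : Type*} [CommRing R] {S : Set R[X]} {R' : Type*} [CommRing R']
    [Algebra R R'] {p : R[X]} (hp : p ∈ S) (z : R') : aeval z p ∈ valueMonoid S R' :=
  Submonoid.subset_closure ⟨p, hp, z, rfl⟩

theorem valueMonoid_image_map {R : Type*} [CommRing R] (S : Set R[X]) (R₁ R₂ : Type*) [CommRing R₁]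
    [CommRing R₂] [Algebra R R₁] [Algebra R₁ R₂] [Algebra R R₂] [IsScalarTower R R₁ R₂] :
    valueMonoid ((fun p => p.map (algebraMap R R₁)) '' S) R₂ = valueMonoid S R₂ := by
  simp [valueMonoid, aeval_map_algebraMap]

theorem map_mem_valueMonoid {R : Type*} [CommRing R] {S : Set R[X]} {R₁ R₂ : Type*} [CommRing R₁]
    [CommRing R₂] [Algebra R R₁] [Algebra R₁ R₂] [Algebra R R₂] [IsScalarTower R R₁ R₂] {x : R₁}
    (hx : x ∈ valueMonoid S R₁) : algebraMap R₁ R₂ x ∈ valueMonoid S R₂ := by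
  have : valueMonoid S R₁ ≤ (valueMonoid S R₂).comap (algebraMap R₁ R₂ : R₁ →* R₂) := by
    refine (Submonoid.closure_le).2 ?_
    rintro _ ⟨p, hp, z, rfl⟩
    rw [SetLike.mem_coe, Submonoid.mem_comap]
    have := aeval_mem_valueMonoid hp (algebraMap R₁ R₂ z)
    rwa [aeval_algebraMap_apply] at this
  exact this hx

/-- The set `S` of polynomials takes, up to higher order terms, nonconstant values on every step of
the unit filtration, and some member of `S` has small enough linear coefficient for Hensel's
lemma. -/
structure IsNormLike {R : Type*} [CommRing R] (ϖ : R) (N : ℕ) (S : Set R[X]) : Prop where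
  exists_step : ∀ n : ℕ, 1 ≤ n → ∃ Q : R[X], ∃ i, 1 ≤ i ∧ IsUnit (Q.coeff i) ∧
    1 + C (ϖ ^ n) * Q ∈ S
  exists_pow : ∃ d : ℕ, 1 ≤ d ∧ X ^ d ∈ S
  exists_linear : ∃ h ∈ S, h.coeff 0 = 1 ∧ h.coeff 1 ^ 2 * ϖ ∣ ϖ ^ N

theorem IsNormLike.map {R R' : Type*} [CommRing R] [CommRing R'] (f : R →+* R') {ϖ : R} {N : ℕ}
    {S : Set R[X]} (h : IsNormLike ϖ N S) :
    IsNormLike (f ϖ) N ((fun p => p.map f) '' S) := by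
  refine ⟨fun n hn => ?_, ?_, ?_⟩
  · obtain ⟨Q, i, hi, hQ, hmem⟩ := h.exists_step n hn
    exact ⟨Q.map f, i, hi, by simpa using hQ.map f, _, hmem, by simp⟩
  · obtain ⟨d, hd, hmem⟩ := h.exists_pow
    exact ⟨d, hd, _, hmem, by simp⟩
  · obtain ⟨p, hp, h0, h1⟩ := h.exists_linear
    exact ⟨_, ⟨p, hp, rfl⟩, by simp [h0], by simpa using map_dvd f h1⟩

theorem IsNormLike.mem_of_dvd {R : Type*} [CommRing R] [IsDomain R] [IsDiscreteValuationRing R]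
    [IsAdicComplete (maximalIdeal R) R] {ϖ : R} (hϖ : Irreducible ϖ) {N : ℕ} {S : Set R[X]}
    (h : IsNormLike ϖ N S) {u : R} (hu : ϖ ^ N ∣ u - 1) : u ∈ valueMonoid S R := by
  obtain ⟨p, hp, h0, e, he⟩ := h.exists_linear
  obtain ⟨c, hc⟩ := hu
  set t := p.coeff 1
  obtain ⟨x, hx⟩ := HenselianRing.exists_add_add_eq_zero (a := -(ϖ * e * c)) (by
    rw [neg_mem_iff, mul_assoc, mem_maximalIdeal]
    exact fun hunit => hϖ.not_isUnit (isUnit_of_mul_isUnit_left hunit))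
    (p.divX.divX.comp (C t * X))
  have hpx (y : R) : p.eval y = 1 + t * y + y ^ 2 * p.divX.divX.eval y := by
    conv_lhs => rw [← p.divX_mul_X_add, ← p.divX.divX_mul_X_add]
    simp only [eval_add, eval_mul, eval_X, eval_C, coeff_divX, h0, t]
    ring
  have : aeval (t * x) p = u := by
    rw [coe_aeval_eq_eval, hpx]
    simp only [eval_comp, eval_mul, eval_C, eval_X] at hx
    linear_combination t ^ 2 * hx - hc - c * he
  rw [← this]
  exact aeval_mem_valueMonoid hp _

theorem IsNormLike.exists_mem_of_dvd {N : ℕ} (k : ℕ) : ∀ {n : ℕ} (_ : n + k = N) {R : Type u}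
    [CommRing R] [IsDomain R] [IsDiscreteValuationRing R] [IsAdicComplete (maximalIdeal R) R]
    {ϖ : R} (_ : Irreducible ϖ) {S : Set R[X]} (_ : IsNormLike ϖ N S) {u : R} (_ : IsUnit u)
    (_ : ϖ ^ n ∣ u - 1),
    ∃ (R' : Type u) (_ : CommRing R') (_ : IsDomain R') (_ : IsDiscreteValuationRing R')
      (_ : IsAdicComplete (maximalIdeal R') R') (_ : Algebra R R'), IsFiniteUnramified R R' ∧
      algebraMap R R' u ∈ valueMonoid S R' := by
  induction k with
  | zero =>
    rintro n rfl R _ _ _ _ ϖ hϖ S h u - hu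
    exact ⟨R, inferInstance, inferInstance, inferInstance, inferInstance, inferInstance,
      .refl R, h.mem_of_dvd hϖ hu⟩
  | succ k ih =>
    rintro n hn R _ _ _ _ ϖ hϖ S h u hu hdvd
    suffices ∃ (R₁ : Type u) (_ : CommRing R₁) (_ : IsDomain R₁) (_ : IsDiscreteValuationRing R₁)
        (_ : IsAdicComplete (maximalIdeal R₁) R₁) (_ : Algebra R R₁), IsFiniteUnramified R R₁ ∧
        ∃ a b : R₁, algebraMap R R₁ u = a * b ∧ a ∈ valueMonoid S R₁ ∧ IsUnit b ∧
          algebraMap R R₁ ϖ ^ (n + 1) ∣ b - 1 by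
      obtain ⟨R₁, _, _, _, _, _, h₁, a, b, hab, ha, hb, hb1⟩ := this
      obtain ⟨R₂, _, _, _, _, _, h₂, hb₂⟩ := ih (by omega) (h₁.irreducible ϖ hϖ)
        (h.map (algebraMap R R₁)) hb hb1
      let _ : Algebra R R₂ := ((algebraMap R₁ R₂).comp (algebraMap R R₁)).toAlgebra
      have : IsScalarTower R R₁ R₂ := .of_algebraMap_eq fun _ => rfl
      refine ⟨R₂, inferInstance, inferInstance, inferInstance, inferInstance, inferInstance,
        h₁.trans h₂, ?_⟩
      rw [IsScalarTower.algebraMap_apply R R₁ R₂, hab, map_mul]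
      rw [valueMonoid_image_map] at hb₂
      exact mul_mem (map_mem_valueMonoid ha) hb₂
    -- it suffices to find a value whose quotient with `u` is closer to `1`
    suffices ∃ (R₁ : Type u) (_ : CommRing R₁) (_ : IsDomain R₁) (_ : IsDiscreteValuationRing R₁)
        (_ : IsAdicComplete (maximalIdeal R₁) R₁) (_ : Algebra R R₁), IsFiniteUnramified R R₁ ∧
        ∃ p ∈ S, ∃ z : R₁, algebraMap R R₁ ϖ ^ (n + 1) ∣ aeval z p - algebraMap R R₁ u by
      obtain ⟨R₁, i₁, i₂, i₃, i₄, i₅, h₁, p, hp, z, hz⟩ := this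
      have hϖ₁ := h₁.irreducible ϖ hϖ
      have hu₁ : IsUnit (algebraMap R R₁ u) := hu.map _
      have hpz : IsUnit (aeval z p) := by
        by_contra hn
        rw [← mem_nonunits_iff, ← mem_maximalIdeal] at hn
        have h2 : aeval z p - algebraMap R R₁ u ∈ maximalIdeal R₁ := by
          rw [hϖ₁.maximalIdeal_eq, Ideal.mem_span_singleton]
          exact (dvd_pow_self _ (Nat.succ_ne_zero n)).trans hz
        have := (maximalIdeal R₁).sub_mem hn h2
        rw [sub_sub_cancel, mem_maximalIdeal] at this
        exact this hu₁
      obtain ⟨e, he⟩ := hpz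
      have hee : (e : R₁) * ↑e⁻¹ = 1 := by simp
      refine ⟨R₁, i₁, i₂, i₃, i₄, i₅, h₁, e, ↑e⁻¹ * algebraMap R R₁ u, ?_, ?_,
        e⁻¹.isUnit.mul hu₁, ?_⟩
      · rw [← mul_assoc, hee, one_mul]
      · rw [he]
        exact aeval_mem_valueMonoid hp z
      · obtain ⟨c, hc⟩ := hz
        refine ⟨-(↑e⁻¹ * c), ?_⟩
        rw [← he] at hc
        linear_combination -↑e⁻¹ * hc + hee
    rcases Nat.eq_zero_or_pos n with rfl | hn1
    · obtain ⟨d, hd, hmem⟩ := h.exists_pow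
      obtain ⟨R₁, i₁, i₂, i₃, i₄, i₅, h₁, z, hz⟩ :=
        IsFiniteUnramified.exists_dvd_aeval_sub hϖ (Q := X ^ d) hd (by simp) u
      exact ⟨R₁, i₁, i₂, i₃, i₄, i₅, h₁, _, hmem, z, by simpa using hz⟩
    · obtain ⟨Q, i, hi, hQ, hmem⟩ := h.exists_step n hn1
      obtain ⟨c, hc⟩ := hdvd
      obtain ⟨R₁, i₁, i₂, i₃, i₄, i₅, h₁, z, e, he⟩ :=
        IsFiniteUnramified.exists_dvd_aeval_sub hϖ hi hQ c
      refine ⟨R₁, i₁, i₂, i₃, i₄, i₅, h₁, _, hmem, z, e, ?_⟩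
      have hc' := congrArg (algebraMap R R₁) hc
      simp only [map_sub, map_one, map_mul, map_pow] at hc'
      simp only [map_add, map_one, map_mul, aeval_C, map_pow]
      linear_combination algebraMap R R₁ ϖ ^ n * he - hc'

/-- Every unit becomes a product of values of `S` after a finite unramified extension. -/
theorem IsNormLike.exists_mem {N : ℕ} {R : Type u}
    [CommRing R] [IsDomain R] [IsDiscreteValuationRing R] [IsAdicComplete (maximalIdeal R) R]
    {ϖ : R} (hϖ : Irreducible ϖ) {S : Set R[X]} (h : IsNormLike ϖ N S) {u : R} (hu : IsUnit u) :
    ∃ (R' : Type u) (_ : CommRing R') (_ : IsDomain R') (_ : IsDiscreteValuationRing R')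
      (_ : IsAdicComplete (maximalIdeal R') R') (_ : Algebra R R'), IsFiniteUnramified R R' ∧
      algebraMap R R' u ∈ valueMonoid S R' :=
  h.exists_mem_of_dvd N (n := 0) (by simp) hϖ hu (by simp)

end NormLike

section NormPolynomials

open WithZero Polynomial

namespace Valuation

section ValuationSubring

variable {K : Type*} [Field K] {v : Valuation K Γ₀}

theorem integers_valuationSubring (v : Valuation K Γ₀) : v.Integers v.valuationSubring :=
  integer.integers v

theorem dvd_valuationSubring_iff {x y : v.valuationSubring} : x ∣ y ↔ v (y : K) ≤ v (x : K) :=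
  (v.integers_valuationSubring).dvd_iff_le

theorem isUnit_valuationSubring_iff {x : v.valuationSubring} : IsUnit x ↔ v (x : K) = 1 :=
  (v.integers_valuationSubring).isUnit_iff_valuation_eq_one

theorem irreducible_of_map_eq_exp {π : v.valuationSubring} (hπ : v (π : K) = exp (-1)) :
    Irreducible π := by
  refine ⟨?_, fun a b hab => ?_⟩
  · rw [isUnit_valuationSubring_iff, hπ, ← exp_zero, exp_inj]
    norm_num
  · by_contra! h
    rw [isUnit_valuationSubring_iff, isUnit_valuationSubring_iff] at h
    have ha : v (a : K) ≤ exp (-1) :=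
      lt_exp_iff.1 (by rw [exp_zero]; exact lt_of_le_of_ne a.2 h.1)
    have hb : v (b : K) ≤ exp (-1) :=
      lt_exp_iff.1 (by rw [exp_zero]; exact lt_of_le_of_ne b.2 h.2)
    have := mul_le_mul' ha hb
    rw [← map_mul, ← exp_add] at this
    have h2 : (π : K) = a * b := by rw [hab]; rfl
    rw [← h2, hπ, exp_le_exp] at this
    omega

theorem isDiscreteValuationRing_of_uniformizer (h : ∃ π : K, v π = exp (-1)) :
    IsDiscreteValuationRing v.valuationSubring := by
  obtain ⟨π, hπ⟩ := h
  have hπ1 : v π ≤ 1 := by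
    rw [hπ, ← exp_zero, exp_le_exp]
    norm_num
  refine IsDiscreteValuationRing.ofHasUnitMulPowIrreducibleFactorization
    ⟨⟨π, hπ1⟩, irreducible_of_map_eq_exp hπ, fun {x} hx => ?_⟩
  obtain ⟨k, hk⟩ := exists_eq_exp ((v.ne_zero_iff).2 (Subtype.coe_injective.ne hx))
  have hk0 : k ≤ 0 := by
    rw [← exp_le_exp, ← hk, exp_zero]
    exact x.2
  obtain ⟨n, rfl⟩ := Int.exists_eq_neg_ofNat hk0
  refine ⟨n, associated_of_dvd_dvd ?_ ?_⟩ <;> rw [dvd_valuationSubring_iff, hk] <;>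
    push_cast <;> rw [map_pow, hπ, exp_pow] <;> simp

end ValuationSubring

theorem isAdicComplete_valuationSubring (K : Type*) [Field K] [Valued K Γ₀] [CompleteSpace K]
    {v : Valuation K Γ₀} (hv : v = Valued.v)
    (h : ∃ π : K, v π = exp (-1)) [IsDiscreteValuationRing v.valuationSubring] :
    IsAdicComplete (IsLocalRing.maximalIdeal v.valuationSubring) v.valuationSubring := by
  obtain ⟨π, hπ⟩ := h
  have hπ1 : v π ≤ 1 := by
    rw [hπ, ← exp_zero, exp_le_exp]
    norm_num
  have key (n : ℕ) (x y : v.valuationSubring) :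
      x ≡ y [SMOD (IsLocalRing.maximalIdeal v.valuationSubring ^ n • ⊤ :
        Submodule v.valuationSubring v.valuationSubring)] ↔ v ((x : K) - y) ≤ exp (-n : ℤ) := by
    rw [SModEq.sub_mem, smul_eq_mul, Ideal.mul_top,
      (irreducible_of_map_eq_exp (v := v) (π := ⟨π, hπ1⟩) hπ).maximalIdeal_eq,
      Ideal.span_singleton_pow, Ideal.mem_span_singleton, dvd_valuationSubring_iff]
    push_cast
    rw [map_pow, hπ, exp_pow]
    simp
  have : IsPrecomplete (IsLocalRing.maximalIdeal v.valuationSubring) v.valuationSubring := by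
    refine ⟨fun f hf => ?_⟩
    simp only [key] at hf ⊢
    have hlt (γ : (MonoidWithZeroHom.ValueGroup₀ (.ofClass (Valued.v : Valuation K Γ₀)))ˣ) :
        ∃ N : ℕ, ∀ x : K, v x ≤ exp (-N : ℤ) → Valued.v.restrict x < γ.1 := by
      have h0 : MonoidWithZeroHom.ValueGroup₀.embedding γ.1 ≠ 0 := by simp
      obtain ⟨k, hk⟩ := exists_eq_exp h0
      refine ⟨(1 - k).toNat, fun x hx => ?_⟩
      rw [Valuation.restrict_lt_iff_lt_embedding, hk, ← hv]
      exact hx.trans_lt (exp_lt_exp.2 (by omega))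
    have hcau : CauchySeq fun n => (f n : K) := by
      rw [CauchySeq, Valued.cauchy_iff]
      refine ⟨inferInstance, fun γ => ?_⟩
      obtain ⟨N, hN⟩ := hlt γ
      refine ⟨(fun n => (f n : K)) '' Set.Ici N, Filter.image_mem_map (Filter.Ici_mem_atTop N), ?_⟩
      rintro _ ⟨m, hm, rfl⟩ _ ⟨n, hn, rfl⟩
      refine hN _ ?_
      have h1 := hf (Set.mem_Ici.1 hm)
      have h2 := hf (Set.mem_Ici.1 hn)
      have := v.map_sub_le h1 h2
      rwa [sub_sub_sub_cancel_left] at this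
    obtain ⟨a, ha⟩ := cauchySeq_tendsto_of_complete hcau
    have hle (n : ℕ) : v ((f n : K) - a) ≤ exp (-n : ℤ) := by
      have hπn : (π : K) ^ n ≠ 0 := pow_ne_zero _ (by rw [← v.ne_zero_iff, hπ]; exact exp_ne_zero)
      have hmem : {y : K | Valued.v.restrict (y - a) < Valued.v.restrict (π ^ n)} ∈ nhds a :=
        Valued.mem_nhds.2 ⟨Units.mk0 (Valued.v.restrict (π ^ n)) (by simpa using hπn), by simp⟩
      obtain ⟨m, hm1, hm2⟩ := ((Filter.eventually_ge_atTop n).and (ha.eventually hmem)).exists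
      have hm2 : v (f m - a) < v (π ^ n) := by
        have := (Valuation.restrict_lt_iff _).1 hm2
        rwa [← hv] at this
      rw [map_pow, hπ, exp_pow] at hm2
      have := v.map_add_le (hf hm1) (by simpa using hm2.le)
      rwa [sub_add_sub_cancel] at this
    refine ⟨⟨a, ?_⟩, hle⟩
    have := v.map_sub_le (f 0).2 ((hle 0).trans (by simp))
    simpa using this
  exact { }

end Valuation

theorem Matrix.aeval_charpolyRev_eq_norm {R A B ι : Type*} [CommRing R] [CommRing A] [CommRing B]
    [Algebra R A] [Algebra A B] [Fintype ι] [DecidableEq ι] (b : Module.Basis ι A B) {y : B}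
    {M : Matrix ι ι R} (hM : M.map (algebraMap R A) = Algebra.leftMulMatrix b y) (z : A) :
    aeval z M.charpolyRev = Algebra.norm A (1 - algebraMap A B z * y) := by
  rw [Algebra.norm_eq_matrix_det b, map_sub, map_mul, map_one, ← hM, Matrix.charpolyRev]
  rw [← AlgHom.coe_toRingHom, RingHom.map_det]
  congr 1
  ext i j
  by_cases hij : i = j <;>
  simp [hij, AlgHom.commutes, Matrix.algebraMap_eq_diagonal, Matrix.diagonal_mul, mul_comm z]

namespace Valuation

/-- A family of polynomials over the valuation ring whose values are norms from `L`. -/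
def normPolys {K L ι : Type*} [Field K] [Field L] [Algebra K L] [Fintype ι] [DecidableEq ι]
    (v : Valuation K Γ₀) (w : Valuation L Γ₀) (b : Module.Basis ι K L) : Set v.valuationSubring[X] :=
  {p | p = X ^ Module.finrank K L ∨ ∃ (y : L) (M : Matrix ι ι v.valuationSubring),
    w y ≤ 1 ∧ M.map (algebraMap v.valuationSubring K) = Algebra.leftMulMatrix b y ∧ p = M.charpolyRev}

namespace IsTotallyRamified

variable {K L : Type*} [Field K] [Field L] [Algebra K L] [FiniteDimensional K L]
  {v : Valuation K Γ₀} {w : Valuation L Γ₀}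

theorem exists_leftMulMatrix (h : IsTotallyRamified v w) {ϖ : L} (hϖ : w ϖ = exp (-1)) {y : L}
    (hy : w y ≤ 1) : ∃ M : Matrix (Fin (Module.finrank K L)) (Fin (Module.finrank K L))
      v.valuationSubring,
      M.map (algebraMap v.valuationSubring K) = Algebra.leftMulMatrix (h.basis hϖ) y := by
  refine ⟨Matrix.of fun i j => ⟨Algebra.leftMulMatrix (h.basis hϖ) y i j, ?_⟩, ?_⟩
  · rw [Algebra.leftMulMatrix_eq_repr_mul]
    refine h.repr_le_one hϖ ?_ i
    rw [basis_apply, map_mul, map_pow, hϖ]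
    exact mul_le_one' hy (pow_le_one₀ zero_le (by rw [← exp_zero, exp_le_exp]; norm_num))
  · ext i j
    rfl

theorem exists_isNormLike [IsGalois K L] (h : IsTotallyRamified v w)
    (hab : ∀ σ τ : L ≃ₐ[K] L, σ * τ = τ * σ) {ϖ : L} (hϖ : w ϖ = exp (-1))
    {π : v.valuationSubring} (hπ : v (π : K) = exp (-1)) :
    ∃ N, IsNormLike π N (v.normPolys w (h.basis hϖ)) := by
  have := v.infinite_of_uniformizer h.exists_uniformizer
  have := isDiscreteValuationRing_of_uniformizer h.exists_uniformizer
  have hπ0 : (π : K) ≠ 0 := by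
    rw [← v.ne_zero_iff, hπ]
    exact exp_ne_zero
  obtain ⟨y, t, ht, hy, hyt⟩ : ∃ (y : L) (t : K), t ≠ 0 ∧ w y ≤ 1 ∧ Algebra.trace K L y = t := by
    obtain ⟨y, hy⟩ := Algebra.trace_surjective K L 1
    obtain ⟨k, hk⟩ := exists_eq_exp ((w.ne_zero_iff (x := y)).2 (by rintro rfl; simp at hy))
    refine ⟨algebraMap K L (π ^ k.toNat) * y, π ^ k.toNat, pow_ne_zero _ hπ0, ?_, ?_⟩
    · rw [map_mul, h.map_algebraMap, map_pow, hπ, exp_pow, exp_pow, hk, ← exp_add, ← exp_zero,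
        exp_le_exp]
      have h1 : (1 : ℤ) ≤ Module.finrank K L := by exact_mod_cast Module.finrank_pos
      have h2 := Int.self_le_toNat k
      nlinarith [k.toNat.cast_nonneg (α := ℤ)]
    · rw [← Algebra.smul_def, map_smul, hy, smul_eq_mul, mul_one]
  obtain ⟨M, hM⟩ := h.exists_leftMulMatrix hϖ hy
  have hcoeff : M.charpolyRev.coeff 1 ≠ 0 := by
    rw [Matrix.coeff_charpolyRev_eq_neg_trace, neg_ne_zero]
    intro h0
    apply ht
    rw [← hyt, Algebra.trace_eq_matrix_trace (h.basis hϖ), ← hM, ← AddMonoidHom.map_trace, h0,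
      map_zero]
  have hirr := irreducible_of_map_eq_exp hπ
  obtain ⟨N, hN⟩ := IsDiscreteValuationRing.associated_pow_irreducible
    (mul_ne_zero (pow_ne_zero 2 hcoeff) hirr.ne_zero) hirr
  refine ⟨N, ?_, ⟨_, Module.finrank_pos, Or.inl rfl⟩, _, Or.inr ⟨y, M, hy, hM, rfl⟩, ?_, hN.dvd⟩
  · intro n hn
    obtain ⟨j, hj⟩ := h.exists_normJump _ hab le_rfl (n := n) (by exact_mod_cast hn)
    obtain ⟨y, hy, q, hq, ⟨i, hi, hqi⟩, hyq⟩ := hj.exists_nonconstant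
    have hc : v ((π : K) ^ n) = exp (-n : ℤ) := by
      rw [map_pow, hπ, exp_pow]
      simp
    obtain ⟨Q, rfl, -⟩ := hq.exists_eq_C_mul_map hc
    have hy1 : w (-y) ≤ 1 := by
      rw [Valuation.map_neg, hy, ← exp_zero, exp_le_exp]
      linarith [hj.one_le]
    obtain ⟨M, hM⟩ := h.exists_leftMulMatrix hϖ hy1
    refine ⟨Q, i, hi, ?_, Or.inr ⟨_, M, hy1, hM, ?_⟩⟩
    · rw [isUnit_valuationSubring_iff]
      rw [coeff_C_mul, map_mul, hc, coeff_map] at hqi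
      exact (mul_eq_left₀ exp_ne_zero).1 hqi
    · apply Polynomial.map_injective (algebraMap v.valuationSubring K) Subtype.coe_injective
      refine Polynomial.funext fun z => ?_
      have := Matrix.aeval_charpolyRev_eq_norm (h.basis hϖ) hM z
      rw [mul_neg, sub_neg_eq_add, hyq] at this
      rw [eval_map_algebraMap (P := M.charpolyRev), this]
      simp
  · rw [coeff_zero_eq_eval_zero, Matrix.eval_charpolyRev]

end IsTotallyRamified

end Valuation

end NormPolynomials

section EisensteinExtension

section Eisenstein

open Polynomial IsLocalRing

/-- An Eisenstein polynomial over a discrete valuation ring defines a discrete valuation ring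
with uniformizer the adjoined root. -/
theorem AdjoinRoot.isDiscreteValuationRing_of_eisenstein {R : Type*} [CommRing R] [IsDomain R]
    [IsDiscreteValuationRing R] {g : R[X]} (hg : g.Monic) (hd : 0 < g.natDegree)
    (hcoeff : ∀ i < g.natDegree, g.coeff i ∈ maximalIdeal R) (h0 : Irreducible (g.coeff 0)) :
    ∃ _ : IsDomain (AdjoinRoot g), IsDiscreteValuationRing (AdjoinRoot g) ∧
      Irreducible (AdjoinRoot.root g) := by
  have hE : g.IsEisensteinAt (maximalIdeal R) := by
    refine ⟨?_, fun {n} hn => hcoeff n hn, ?_⟩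
    · rw [hg.leadingCoeff]
      exact (Ideal.ne_top_iff_one _).1 (maximalIdeal.isMaximal R).ne_top
    · rw [h0.maximalIdeal_eq, Ideal.span_singleton_pow, Ideal.mem_span_singleton]
      intro h
      refine h0.not_isUnit ?_
      obtain ⟨c, hc⟩ := h
      have : g.coeff 0 * c = 1 := by
        apply mul_left_cancel₀ h0.ne_zero
        linear_combination -hc
      exact .of_mul_eq_one _ this
  have hirr : Irreducible g :=
    hE.irreducible (maximalIdeal.isMaximal R).isPrime hg.isPrimitive hd
  have hdom : IsDomain (AdjoinRoot g) := AdjoinRoot.isDomain_of_prime hirr.prime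
  refine ⟨hdom, ?_⟩
  have := hg.finite_adjoinRoot
  have hroot : root g ∣ of g (g.coeff 0) := by
    have h1 : mk g (X * g.divX + C (g.coeff 0)) = 0 := by
      rw [X_mul_divX_add, mk_self]
    rw [map_add, map_mul, mk_X, mk_C, add_eq_zero_iff_neg_eq'] at h1
    rw [← dvd_neg, h1]
    exact dvd_mul_right _ _
  have hev : eval₂ (residue R) 0 g = 0 := by
    rw [eval₂_at_zero, residue_eq_zero_iff]
    exact hcoeff 0 hd
  have hker : RingHom.ker (lift (residue R) 0 hev) = Ideal.span {root g} := by
    apply le_antisymm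
    · intro x hx
      obtain ⟨p, rfl⟩ := mk_surjective x
      rw [RingHom.mem_ker, lift_mk, eval₂_at_zero, residue_eq_zero_iff, h0.maximalIdeal_eq,
        Ideal.mem_span_singleton] at hx
      rw [Ideal.mem_span_singleton, ← p.X_mul_divX_add, map_add, map_mul, mk_X, mk_C]
      exact dvd_add (dvd_mul_right _ _) (hroot.trans (map_dvd _ hx))
    · rw [Ideal.span_singleton_le_iff_mem, RingHom.mem_ker, lift_root]
  refine IsDiscreteValuationRing.of_finite (A := R) h0 (k := g.natDegree) ?_ ?_ ?_
  · rw [← hker]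
    refine RingHom.ker_isMaximal_of_surjective _ fun y => ?_
    obtain ⟨r, rfl⟩ := residue_surjective y
    exact ⟨of g r, by simp⟩
  · intro hzero
    rw [hzero, zero_dvd_iff, map_eq_zero_iff _ (of.injective_of_degree_ne_zero
      (natDegree_pos_iff_degree_pos.1 hd).ne')] at hroot
    exact h0.ne_zero hroot
  · have : C (g.coeff 0) ∣ g - X ^ g.natDegree := by
      rw [C_dvd_iff_dvd_coeff]
      intro i
      rw [coeff_sub, coeff_X_pow]
      rcases lt_trichotomy i g.natDegree with hi | hi | hi
      · rw [if_neg hi.ne, sub_zero, ← Ideal.mem_span_singleton, ← h0.maximalIdeal_eq]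
        exact hcoeff i hi
      · rw [if_pos hi, hi, hg.coeff_natDegree, sub_self]
        exact dvd_zero _
      · rw [if_neg hi.ne', coeff_eq_zero_of_natDegree_lt hi, sub_zero]
        exact dvd_zero _
    have h2 := map_dvd (mk g) this
    rwa [map_sub, mk_self, zero_sub, dvd_neg, map_pow, mk_X, mk_C] at h2

end Eisenstein

open WithZero

theorem IsDiscreteValuationRing.valuation_irreducible {A F : Type*} [CommRing A] [IsDomain A]
    [IsDiscreteValuationRing A] [Field F] [Algebra A F] [IsFractionRing A F] {a : A}
    (ha : Irreducible a) :
    (IsDiscreteValuationRing.maximalIdeal A).valuation F (algebraMap A F a) = exp (-1) := by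
  rw [IsDedekindDomain.HeightOneSpectrum.valuation_of_algebraMap]
  exact IsDedekindDomain.HeightOneSpectrum.intValuation_singleton _ ha.ne_zero ha.maximalIdeal_eq

namespace Valuation

theorem map_eq_of_le_one {K F : Type*} [Field K] [Field F] {v : Valuation K Γ₀}
    {V : Valuation F Γ₀} (f : K →+* F) {π : K} (hπ : v π = exp (-1)) (hπ' : V (f π) = exp (-1))
    (h : ∀ x, v x ≤ 1 → V (f x) ≤ 1) (x : K) : V (f x) = v x := by
  rcases eq_or_ne x 0 with rfl | hx
  · simp
  have h1 (y : K) (hy : v y = 1) : V (f y) = 1 := by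
    refine le_antisymm (h y hy.le) ?_
    have := h y⁻¹ (by rw [map_inv₀, hy, inv_one])
    have hy0 : y ≠ 0 := by
      rintro rfl
      simp at hy
    rw [map_inv₀, map_inv₀] at this
    refine (inv_le_one₀ ?_).1 this
    rw [zero_lt_iff, V.ne_zero_iff]
    exact (map_ne_zero f).2 hy0
  obtain ⟨k, hk⟩ := exists_eq_exp ((v.ne_zero_iff).2 hx)
  have h2 := h1 (x * π ^ k) (by rw [map_mul, map_zpow₀, hk, hπ, ← exp_zsmul, ← exp_add]; simp)
  rw [map_mul, map_zpow₀, map_mul, map_zpow₀, hπ', ← exp_zsmul] at h2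
  refine mul_right_cancel₀ (b := exp (k • (-1))) exp_ne_zero ?_
  rw [h2, hk, ← exp_add]
  simp

end Valuation

end EisensteinExtension

section Witness

open WithZero nonZeroDivisors

theorem Algebra.isUnit_of_isUnit_norm {R S : Type*} [CommRing R] [CommRing S] [Algebra R S]
    [Module.Free R S] [Module.Finite R S] {s : S} (h : IsUnit (Algebra.norm R s)) : IsUnit s := by
  rw [Algebra.norm_apply, ← LinearMap.isUnit_iff_isUnit_det, Module.End.isUnit_iff] at h
  obtain ⟨t, ht⟩ := h.2 1
  exact .of_mul_eq_one t ht

theorem Module.Basis.repr_eq_map_of_map_eq {K L K' L' ι : Type*} [Field K] [Field L] [Field K']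
    [Field L'] [Algebra K L] [Algebra K K'] [Algebra K' L'] [Algebra K L'] [IsScalarTower K K' L']
    [Fintype ι] (b : Basis ι K L) (b' : Basis ι K' L') (φ : L →ₐ[K] L') (h : ∀ i, φ (b i) = b' i)
    (x : L) (i : ι) : b'.repr (φ x) i = algebraMap K K' (b.repr x i) := by
  classical
  conv_lhs => rw [← b.sum_repr x]
  simp only [map_sum, map_smul, h]
  simp only [← algebraMap_smul K' (_ : K) (_ : L'), map_smul]
  simp [Finsupp.single_apply, Algebra.smul_def]

open Valuation in
/-- The field extensions constructed from a finite unramified extension `R'` of the valuation ring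
`R` and its totally ramified extension `S'` generated by a root of the minimal polynomial of a
uniformizer of `L`. -/
theorem nonempty_unramifiedNormWitness_of_mem.{u₁, u₂, u₃, u₄} {K : Type u₁} {L : Type u₂}
    {K' : Type u₃} {L' : Type u₄} {R' S' : Type*} [Field K] [Field L]
    [Field K'] [Field L'] [Algebra K L] [FiniteDimensional K L] [Valued K Γ₀] [Valued L Γ₀]
    {v : Valuation K Γ₀} (hv : v = Valued.v) {w : Valuation L Γ₀} (hw : w = Valued.v)
    (h : IsTotallyRamified v w) {ϖ : L} (hϖ : w ϖ = exp (-1))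
    [CommRing R'] [IsDomain R'] [IsDiscreteValuationRing R']
    [CommRing S'] [IsDomain S'] [IsDiscreteValuationRing S']
    [Algebra R' K'] [IsFractionRing R' K'] [Algebra S' L'] [IsFractionRing S' L']
    [Algebra v.valuationSubring R'] [Algebra v.valuationSubring K'] [Algebra K K']
    [IsScalarTower v.valuationSubring R' K'] [IsScalarTower v.valuationSubring K K']
    [Algebra R' S'] [Algebra R' L'] [Algebra K' L'] [IsScalarTower R' S' L']
    [IsScalarTower R' K' L'] [Algebra K L'] [IsScalarTower K K' L']
    (hR' : IsFiniteUnramified v.valuationSubring R')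
    (b : Module.Basis (Fin (Module.finrank K L)) R' S') {θ : S'} (hb : ∀ i, b i = θ ^ (i : ℕ))
    (hθ : Irreducible θ) (φ : L →ₐ[K] L') (hφ : φ ϖ = algebraMap S' L' θ) {u : v.valuationSubring}
    (hu : v (u : K) = 1)
    (hmem : algebraMap v.valuationSubring R' u ∈ valueMonoid (v.normPolys w (h.basis hϖ)) R') :
    Nonempty (UnramifiedNormWitness.{u₁, u₂, u₃, u₄} K L (u : K)) := by
  classical
  set V' : Valuation K' Γ₀ := (IsDiscreteValuationRing.maximalIdeal R').valuation K' with hV'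
  set W' : Valuation L' Γ₀ := (IsDiscreteValuationRing.maximalIdeal S').valuation L' with hW'
  have hfin := hR'.finite
  have hfaith : FaithfulSMul v.valuationSubring R' := (faithfulSMul_iff_algebraMap_injective _ _).2 hR'.injective
  have hfree : Module.Free R' S' := .of_basis b
  have hfin' : Module.Finite R' S' := .of_basis b
  have hfaith' : FaithfulSMul R' S' := inferInstance
  have hfinK' : Module.Finite K K' := .of_isLocalization v.valuationSubring R' v.valuationSubring⁰
  have hfinL' : Module.Finite K' L' := .of_isLocalization R' S' R'⁰
  set b' := b.localizationLocalization K' R'⁰ L' with hb'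
  have hbb' (i) : φ (h.basis hϖ i) = b' i := by
    rw [hb', Module.Basis.localizationLocalization_apply, hb, h.basis_apply, map_pow, map_pow, hφ]
  have hrepr := (h.basis hϖ).repr_eq_map_of_map_eq b' φ hbb'
  obtain ⟨π, hπ⟩ := h.exists_uniformizer
  have hπ1 : v π ≤ 1 := by
    rw [hπ, ← exp_zero, exp_le_exp]
    norm_num
  have hvK (x : v.valuationSubring) : V' (algebraMap K K' (x : K)) ≤ 1 := by
    have : algebraMap K K' (x : K) = algebraMap R' K' (algebraMap v.valuationSubring R' x) := by
      rw [← IsScalarTower.algebraMap_apply v.valuationSubring R' K', IsScalarTower.algebraMap_apply v.valuationSubring K K']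
      rfl
    rw [this]
    exact IsDedekindDomain.HeightOneSpectrum.valuation_le_one _ _
  have hVπ : V' (algebraMap K K' π) = exp (-1) := by
    have : algebraMap K K' π = algebraMap R' K' (algebraMap v.valuationSubring R' ⟨π, hπ1⟩) := by
      rw [← IsScalarTower.algebraMap_apply v.valuationSubring R' K', IsScalarTower.algebraMap_apply v.valuationSubring K K']
      rfl
    rw [this]
    exact IsDiscreteValuationRing.valuation_irreducible
      (hR'.irreducible _ (irreducible_of_map_eq_exp hπ))
  have hvV (x : K) : V' (algebraMap K K' x) = v x :=
    map_eq_of_le_one (algebraMap K K') hπ hVπ (fun x hx => hvK ⟨x, hx⟩) x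
  have hVW (x : K') (hx : V' x ≤ 1) : W' (algebraMap K' L' x) ≤ 1 := by
    obtain ⟨a, rfl⟩ := IsDiscreteValuationRing.exists_lift_of_le_one hx
    rw [← IsScalarTower.algebraMap_apply R' K' L', IsScalarTower.algebraMap_apply R' S' L']
    exact IsDedekindDomain.HeightOneSpectrum.valuation_le_one _ _
  have hWϖ : W' (φ ϖ) = exp (-1) := by
    rw [hφ]
    exact IsDiscreteValuationRing.valuation_irreducible hθ
  have hwle (x : L) (hx : w x ≤ 1) : W' (φ x) ≤ 1 := by
    rw [← h.sum_repr hϖ x, map_sum]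
    refine W'.map_sum_le fun i _ => ?_
    rw [Algebra.smul_def, map_mul, AlgHom.commutes, map_mul, map_pow, map_pow, hWϖ,
      IsScalarTower.algebraMap_apply K K' L']
    refine mul_le_one' (hVW _ ?_) (pow_le_one₀ zero_le ?_)
    · rw [hvV]
      exact h.repr_le_one hϖ hx i
    · rw [← exp_zero, exp_le_exp]
      norm_num
  have hwW (x : L) : W' (φ x) = w x := map_eq_of_le_one (φ : L →+* L') hϖ hWϖ hwle x
  have hval (x : R') (hx : x ∈ valueMonoid (v.normPolys w (h.basis hϖ)) R') :
      ∃ s : S', Algebra.norm R' s = x := by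
    induction hx using Submonoid.closure_induction with
    | one => exact ⟨1, map_one _⟩
    | mul x y _ _ hx hy =>
      obtain ⟨s, rfl⟩ := hx
      obtain ⟨t, rfl⟩ := hy
      exact ⟨s * t, map_mul _ _ _⟩
    | mem x hx =>
      obtain ⟨p, hp | ⟨y, M, hy, hM, rfl⟩, z, rfl⟩ := hx
      · refine ⟨algebraMap R' S' z, ?_⟩
        rw [Algebra.norm_algebraMap_of_basis b, hp]
        simp
      · have hle : W' (1 - algebraMap K' L' (algebraMap R' K' z) * φ y) ≤ 1 := by
          refine W'.map_sub_le (by simp) ?_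
          rw [map_mul]
          exact mul_le_one' (hVW _ (IsDedekindDomain.HeightOneSpectrum.valuation_le_one _ _))
            (hwle y hy)
        obtain ⟨s, hs⟩ := IsDiscreteValuationRing.exists_lift_of_le_one hle
        refine ⟨s, IsFractionRing.injective R' K' ?_⟩
        rw [← Algebra.norm_localization R' R'⁰ (Rₘ := K') (Sₘ := L'), hs,
          ← Polynomial.aeval_algebraMap_apply]
        symm
        refine Matrix.aeval_charpolyRev_eq_norm b' (y := φ y) ?_ _
        ext i j
        have := congrArg (algebraMap K K') (congrFun (congrFun hM i) j)
        rw [Algebra.leftMulMatrix_eq_repr_mul, ← hrepr, map_mul, hbb',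
          ← Algebra.leftMulMatrix_eq_repr_mul] at this
        rw [← this, Matrix.map_apply, Matrix.map_apply,
          ← IsScalarTower.algebraMap_apply v.valuationSubring K K']
  obtain ⟨s, hs⟩ := hval _ hmem
  have hsunit : IsUnit s := Algebra.isUnit_of_isUnit_norm (R := R') (by
    rw [hs]
    exact (isUnit_valuationSubring_iff.2 hu).map _)
  let _ : Valued K' Γ₀ := Valued.mk' V'
  let _ : Valued L' Γ₀ := Valued.mk' W'
  let _ : Algebra L L' := φ.toAlgebra
  have htow : IsScalarTower K L L' := .of_algebraMap_eq fun x => (φ.commutes x).symm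
  refine ⟨{
    K' := K'
    L' := L'
    unram := fun x => (hvV x).trans (by rw [hv])
    normalized := ⟨_, hVπ⟩
    unramL := fun x => (hwW x).trans (by rw [hw])
    compositum := ?_
    u' := algebraMap S' L' s
    hu' := ?_
    hnorm := ?_ }⟩
  · refine eq_top_iff.2 fun x _ => ?_
    rw [← b'.sum_repr x]
    refine sum_mem fun i _ => ?_
    rw [Algebra.smul_def, ← hbb']
    exact mul_mem (Algebra.subset_adjoin (Or.inl ⟨_, rfl⟩)) (Algebra.subset_adjoin (Or.inr ⟨_, rfl⟩))
  · exact Integers.one_of_isUnit' hsunit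
      fun a => IsDedekindDomain.HeightOneSpectrum.valuation_le_one _ a
  · rw [Algebra.norm_localization R' R'⁰ (Rₘ := K') (Sₘ := L'), hs,
      ← IsScalarTower.algebraMap_apply v.valuationSubring R' K', IsScalarTower.algebraMap_apply v.valuationSubring K K']
    rfl

end Witness

section Small

universe u u₁ u₂ u₃

theorem IsFractionRing.small (R : Type u₁) (K : Type u₂) [CommRing R] [Field K] [Algebra R K]
    [IsFractionRing R K] [Small.{u} R] : Small.{u} K :=
  small_of_surjective (f := fun x : R × R => algebraMap R K x.1 / algebraMap R K x.2) fun x => by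
    obtain ⟨a, b, -, h⟩ := IsFractionRing.div_surjective (A := R) x
    exact ⟨(a, b), h⟩

theorem exists_isFractionRing (R : Type u₁) [CommRing R] [IsDomain R] [Small.{u} R] :
    ∃ (K : Type u) (_ : Field K) (_ : Algebra R K), IsFractionRing R K := by
  have := IsFractionRing.small.{u} R (FractionRing R)
  exact ⟨Shrink.{u} (FractionRing R), inferInstance, inferInstance,
    IsLocalization.isLocalization_of_algEquiv _ (Shrink.algEquiv R (FractionRing R)).symm⟩

theorem IsHausdorff.small (R : Type u₁) [CommRing R] (I : Ideal R) [IsHausdorff I R]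
    (hI : I.FG) [Finite (R ⧸ I)] : Small.{u} R := by
  have (n : ℕ) : Finite (R ⧸ I ^ n) := Ideal.finite_quotient_pow hI n
  refine small_of_injective (f := fun (x : R) (n : ℕ) => Ideal.Quotient.mk (I ^ n) x) ?_
  intro x y h
  rw [← sub_eq_zero]
  refine IsHausdorff.haus ‹_› _ fun n => ?_
  rw [SModEq.zero, smul_eq_mul, Ideal.mul_top]
  exact (Ideal.Quotient.mk_eq_mk_iff_sub_mem x y).1 (congrFun h n)

end Small

section MinimalPolynomial

open WithZero Polynomial

namespace Valuation.IsTotallyRamified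

variable {K L : Type*} [Field K] [Field L] [Algebra K L] [FiniteDimensional K L]
  {v : Valuation K Γ₀} {w : Valuation L Γ₀}

/-- The power basis of a totally ramified extension generated by a uniformizer. -/
@[simps]
noncomputable def powerBasis (h : IsTotallyRamified v w) {ϖ : L} (hϖ : w ϖ = exp (-1)) :
    PowerBasis K L where
  gen := ϖ
  dim := Module.finrank K L
  basis := h.basis hϖ
  basis_eq_pow := h.basis_apply hϖ

theorem coeff_minpoly (h : IsTotallyRamified v w) {ϖ : L} (hϖ : w ϖ = exp (-1)) {i : ℕ}
    (hi : i < Module.finrank K L) : v ((minpoly K ϖ).coeff i) < 1 := by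
  have : (minpoly K ϖ).coeff i =
      -(h.basis hϖ).repr (ϖ ^ Module.finrank K L) ⟨i, hi⟩ := by
    have := (h.powerBasis hϖ).minpolyGen_eq
    rw [powerBasis_gen] at this
    rw [← this, PowerBasis.minpolyGen]
    simp only [coeff_sub, coeff_X_pow, finsetSum_coeff, coeff_C_mul, powerBasis_dim]
    rw [if_neg hi.ne, zero_sub, Finset.sum_eq_single ⟨i, hi⟩]
    · simp only [if_true, mul_one]
      rfl
    · intro j _ hj
      rw [if_neg fun hij => hj (Fin.ext hij.symm), mul_zero]
    · simp
  rw [this, map_neg]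
  exact h.repr_pow_finrank_lt_one hϖ _

theorem coeff_zero_minpoly [IsGalois K L] (h : IsTotallyRamified v w) {ϖ : L}
    (hϖ : w ϖ = exp (-1)) : v ((minpoly K ϖ).coeff 0) = exp (-1) := by
  have := Algebra.PowerBasis.norm_gen_eq_coeff_zero_minpoly (h.powerBasis hϖ)
  rw [powerBasis_gen] at this
  rw [← hϖ, ← h.map_norm, this, map_mul, map_pow, map_neg, map_one, one_pow, one_mul]

theorem exists_map_eq_minpoly [IsGalois K L] (h : IsTotallyRamified v w) {ϖ : L}
    (hϖ : w ϖ = exp (-1)) : ∃ g : v.valuationSubring[X], g.Monic ∧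
      g.natDegree = Module.finrank K L ∧ g.map (algebraMap v.valuationSubring K) = minpoly K ϖ ∧
      (∀ i < Module.finrank K L, v (g.coeff i : K) < 1) ∧ v (g.coeff 0 : K) = exp (-1) := by
  have hmonic := minpoly.monic (Algebra.IsIntegral.isIntegral (R := K) ϖ)
  have hdeg : (minpoly K ϖ).natDegree = Module.finrank K L := (h.powerBasis hϖ).natDegree_minpoly
  have hlift : minpoly K ϖ ∈ lifts (algebraMap v.valuationSubring K) := by
    rw [lifts_iff_coeff_lifts]
    intro i
    rcases lt_trichotomy i (Module.finrank K L) with hi | hi | hi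
    · exact ⟨⟨_, (h.coeff_minpoly hϖ hi).le⟩, rfl⟩
    · exact ⟨1, by rw [hi, ← hdeg, hmonic.coeff_natDegree, map_one]⟩
    · exact ⟨0, by rw [coeff_eq_zero_of_natDegree_lt (hdeg.trans_lt hi), map_zero]⟩
  obtain ⟨g, hg, hd, hgm⟩ := lifts_and_natDegree_eq_and_monic hlift hmonic
  have hc (i) : (g.coeff i : K) = (minpoly K ϖ).coeff i := by
    rw [← hg, coeff_map]
    rfl
  refine ⟨g, hgm, hd.trans hdeg, hg, fun i hi => ?_, ?_⟩
  · rw [hc]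
    exact h.coeff_minpoly hϖ hi
  · rw [hc]
    exact h.coeff_zero_minpoly hϖ

end Valuation.IsTotallyRamified

end MinimalPolynomial

section Construction

open WithZero Polynomial Valuation

theorem Valuation.finite_residue {K : Type*} [Field K] {v : Valuation K Γ₀}
    [IsDiscreteValuationRing v.valuationSubring]
    (hres : ∃ S : Finset K, ∀ x : K, v x ≤ 1 → ∃ s ∈ S, v (x - s) < 1) :
    Finite (v.valuationSubring ⧸ IsLocalRing.maximalIdeal v.valuationSubring) := by
  obtain ⟨S, hS⟩ := hres
  choose f hf hfv using fun x : v.valuationSubring => hS x x.2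
  have hinj : Function.Injective
      fun y : v.valuationSubring ⧸ IsLocalRing.maximalIdeal v.valuationSubring =>
        (⟨f y.out, hf _⟩ : S) := by
    intro y z hyz
    rw [← y.out_eq, ← z.out_eq]
    refine (Ideal.Quotient.mk_eq_mk_iff_sub_mem _ _).2 ?_
    rw [IsLocalRing.mem_maximalIdeal, mem_nonunits_iff, isUnit_valuationSubring_iff]
    have h1 := hfv y.out
    have h2 := hfv z.out
    rw [← (Subtype.mk.inj hyz :)] at h2
    have := v.map_sub_lt h1 h2
    rw [sub_sub_sub_cancel_right] at this
    exact this.ne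
  exact Finite.of_injective _ hinj

theorem nonempty_unramifiedNormWitness.{u₁, u₂, u₃, u₄} {K : Type u₁} {L : Type u₂} [Field K]
    [Field L] [Algebra K L] [Valued K Γ₀] [Valued L Γ₀] [CompleteSpace K] [FiniteDimensional K L]
    [IsGalois K L] {v : Valuation K Γ₀} (hv : v = Valued.v) {w : Valuation L Γ₀}
    (hw : w = Valued.v) (h : IsTotallyRamified v w) (hab : ∀ σ τ : L ≃ₐ[K] L, σ * τ = τ * σ)
    (hres : ∃ S : Finset K, ∀ x : K, v x ≤ 1 → ∃ s ∈ S, v (x - s) < 1) {u : K} (hu : v u = 1) :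
    Nonempty (UnramifiedNormWitness.{u₁, u₂, u₃, u₄} K L u) := by
  obtain ⟨π, hπ⟩ := h.exists_uniformizer
  have hπ1 : v π ≤ 1 := by
    rw [hπ, ← exp_zero, exp_le_exp]
    norm_num
  obtain ⟨ϖ, hϖ⟩ := h.exists_uniformizer'
  have := isDiscreteValuationRing_of_uniformizer h.exists_uniformizer
  have := isAdicComplete_valuationSubring K hv h.exists_uniformizer
  have hfinres := finite_residue hres
  have hirr : Irreducible (⟨π, hπ1⟩ : v.valuationSubring) := irreducible_of_map_eq_exp hπ
  obtain ⟨N, hN⟩ := h.exists_isNormLike hab hϖ (π := ⟨π, hπ1⟩) hπ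
  obtain ⟨R', _, _, _, _, _, hR', hmem⟩ := hN.exists_mem hirr (u := ⟨u, hu.le⟩)
    (isUnit_valuationSubring_iff.2 hu)
  have := hR'.finite
  obtain ⟨g, hgm, hgd, hg, hgc, hg0⟩ := h.exists_map_eq_minpoly hϖ
  set g' := g.map (algebraMap v.valuationSubring R') with hg'
  have hgm' : g'.Monic := hgm.map _
  have hgd' : g'.natDegree = Module.finrank K L := by rw [hg', hgm.natDegree_map, hgd]
  have hirr' := hR'.irreducible _ hirr
  obtain ⟨_, _, hθ⟩ := AdjoinRoot.isDiscreteValuationRing_of_eisenstein hgm'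
    (hgd'.symm ▸ Module.finrank_pos) (fun i hi => by
      rw [hirr'.maximalIdeal_eq, Ideal.mem_span_singleton, hg', coeff_map]
      refine map_dvd _ (dvd_valuationSubring_iff.2 ?_)
      change v (g.coeff i : K) ≤ v π
      rw [hπ]
      exact lt_exp_iff.1 (hgc i (hgd' ▸ hi))) (by
      rw [hg', coeff_map]
      exact hR'.irreducible _ (irreducible_of_map_eq_exp hg0))
  have := hgm'.finite_adjoinRoot
  have : FaithfulSMul v.valuationSubring R' :=
    (faithfulSMul_iff_algebraMap_injective _ _).2 hR'.injective
  have hinj : Function.Injective (algebraMap R' (AdjoinRoot g')) := by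
    have := hgm'.free_adjoinRoot
    exact FaithfulSMul.algebraMap_injective _ _
  have h₀ : Small.{u₃} v.valuationSubring := IsHausdorff.small _ _
    (IsNoetherian.noetherian (IsLocalRing.maximalIdeal v.valuationSubring))
  have h₁ : Small.{u₃} R' := Module.Finite.small v.valuationSubring R'
  have h₀' : Small.{u₄} v.valuationSubring := IsHausdorff.small _ _
    (IsNoetherian.noetherian (IsLocalRing.maximalIdeal v.valuationSubring))
  have h₁' : Small.{u₄} R' := Module.Finite.small v.valuationSubring R'
  have h₂ : Small.{u₄} (AdjoinRoot g') := Module.Finite.small R' (AdjoinRoot g')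
  obtain ⟨K', _, _, _⟩ := exists_isFractionRing.{u₃} R'
  obtain ⟨L', _, _, _⟩ := exists_isFractionRing.{u₄} (AdjoinRoot g')
  let _ : Algebra v.valuationSubring K' :=
    ((algebraMap R' K').comp (algebraMap v.valuationSubring R')).toAlgebra
  have htow : IsScalarTower v.valuationSubring R' K' := .of_algebraMap_eq fun _ => rfl
  let _ : Algebra K K' := (IsFractionRing.lift (K := K) (g := algebraMap v.valuationSubring K')
    ((IsFractionRing.injective R' K').comp hR'.injective)).toAlgebra
  have htow' : IsScalarTower v.valuationSubring K K' := .of_algebraMap_eq fun x =>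
    (IsFractionRing.lift_algebraMap _ _).symm
  let _ : Algebra R' L' := ((algebraMap (AdjoinRoot g') L').comp (algebraMap R' _)).toAlgebra
  have : IsScalarTower R' (AdjoinRoot g') L' := .of_algebraMap_eq fun _ => rfl
  let _ : Algebra K' L' := (IsFractionRing.lift (K := K') (g := algebraMap R' L')
    ((IsFractionRing.injective (AdjoinRoot g') L').comp hinj)).toAlgebra
  have : IsScalarTower R' K' L' := .of_algebraMap_eq fun x =>
    (IsFractionRing.lift_algebraMap _ _).symm
  let _ : Algebra K L' := ((algebraMap K' L').comp (algebraMap K K')).toAlgebra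
  have : IsScalarTower K K' L' := .of_algebraMap_eq fun _ => rfl
  have hroot : aeval (algebraMap (AdjoinRoot g') L' (AdjoinRoot.root g'))
      (minpoly K (h.powerBasis hϖ).gen) = 0 := by
    rw [IsTotallyRamified.powerBasis_gen, ← hg, aeval_def, eval₂_map]
    have : (algebraMap K L').comp (algebraMap v.valuationSubring K) =
        (algebraMap (AdjoinRoot g') L').comp ((AdjoinRoot.of g').comp
          (algebraMap v.valuationSubring R')) := by
      ext x
      simp only [RingHom.comp_apply]
      rw [IsScalarTower.algebraMap_apply K K' L', ← IsScalarTower.algebraMap_apply _ K K',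
        IsScalarTower.algebraMap_apply _ R' K', ← IsScalarTower.algebraMap_apply R' K' L',
        IsScalarTower.algebraMap_apply R' (AdjoinRoot g') L', AdjoinRoot.algebraMap_eq]
    rw [this, ← hom_eval₂, ← eval₂_map, ← hg', AdjoinRoot.eval₂_root, map_zero]
  refine nonempty_unramifiedNormWitness_of_mem (K' := K') (L' := L') hv hw h hϖ hR'
    ((AdjoinRoot.powerBasis' hgm').basis.reindex (finCongr hgd')) (fun i => ?_) hθ
    ((h.powerBasis hϖ).lift _ hroot) ?_ (u := ⟨u, hu.le⟩) hu hmem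
  · rw [Module.Basis.reindex_apply, PowerBasis.basis_eq_pow]
    rfl
  · exact (h.powerBasis hϖ).lift_gen _ hroot

end Construction

/-- Lemma 2.4: let `K` be a local field (complete discretely valued with finite residue
field) and `L/K` a finite totally ramified abelian extension.  Then every unit
`u ∈ O_K^×` becomes a norm after a finite unramified base change: there are a finite
unramified extension `K'/K` and a unit `u' ∈ O_{L'}^×`, `L' = K'L`, with
`u = N_{L'/K'}(u')`. -/
theorem stmt3 (K L : Type*) [Field K] [Field L] [Algebra K L]
    [Valued K Γ₀] [Valued L Γ₀] [CompleteSpace K]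
    [FiniteDimensional K L] [IsGalois K L]
    (hab : ∀ σ τ : L ≃ₐ[K] L, σ * τ = τ * σ)
    (hdK : ∃ π : K, Valued.v π =
      ((Multiplicative.ofAdd (-1 : ℤ) : Multiplicative ℤ) : Γ₀))
    (hdL : ∃ π : L, Valued.v π =
      ((Multiplicative.ofAdd (-1 : ℤ) : Multiplicative ℤ) : Γ₀))
    (hres : ∃ S : Finset K, ∀ x : K, Valued.v x ≤ 1 → ∃ s ∈ S, Valued.v (x - s) < 1)
    (htr : ∀ x : K, Valued.v (algebraMap K L x) = (Valued.v x) ^ (Module.finrank K L))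
    (u : K) (hu : Valued.v u = 1) :
    Nonempty (UnramifiedNormWitness K L u) := by
  exact nonempty_unramifiedNormWitness rfl rfl ⟨hdK, hdL, htr⟩ hab hres hu
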